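/- Let R be a family of operators on ℝ^n, h ∈ (0,1), with h^l (h∂_h)^α ⟨Δ⟩^β R ⟨Δ⟩^γ uniformly bounded on L²(ℝ^n) for all α, β, γ ∈ ℕ and with properly supported kernels. Then the Schwartz kernel κ(R)(x,y,h) satisfies sup |h^l (h∂_h)^α ∂_x^β ∂_y^γ κ(R)| ≤ C_{αβγ} for all multi-indices; conversely, if the kernel bounds hold (and the kernel is compactly supported in x−y uniformly), then the operator bounds hold. -/

import Mathlib

open MeasureTheory FourierTransform
open scoped ENNReal

noncomputable section

variable (n : ℕ)

/-- ⟨Δ⟩^β = (1+Δ)^{β/2}, realized as the Fourier multiplier (1+4π²|ξ|²)^{β/2}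
(any equivalent smooth elliptic weight of order β; here (1+‖ξ‖²)^{β/2}). -/
def japaneseBracket (β : ℕ) (f : EuclideanSpace ℝ (Fin n) → ℂ) :
    EuclideanSpace ℝ (Fin n) → ℂ :=
  fun x => 𝓕⁻ (fun ξ => (((1 + ‖ξ‖ ^ 2) ^ ((β : ℝ) / 2) : ℝ) : ℂ) * 𝓕 f ξ) x

/-- The operator with Schwartz kernel κ(·,·,h). -/
def kernelOp (κ : EuclideanSpace ℝ (Fin n) → EuclideanSpace ℝ (Fin n) → ℝ → ℂ)
    (h : ℝ) (u : EuclideanSpace ℝ (Fin n) → ℂ) : EuclideanSpace ℝ (Fin n) → ℂ :=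
  fun x => ∫ y, κ x y h * u y

/-- (h∂_h) acting on an h-family of functions. -/
def hDh (f : ℝ → EuclideanSpace ℝ (Fin n) → ℂ) : ℝ → EuclideanSpace ℝ (Fin n) → ℂ :=
  fun h x => h * deriv (fun h' => f h' x) h

/-- (h∂_h) acting on an h-family of kernels. -/
def hDhK (κ : EuclideanSpace ℝ (Fin n) → EuclideanSpace ℝ (Fin n) → ℝ → ℂ) :
    EuclideanSpace ℝ (Fin n) → EuclideanSpace ℝ (Fin n) → ℝ → ℂ :=
  fun x y h => h * deriv (fun h' => κ x y h') h

/-- Uniform L²-operator bounds: h^l (h∂_h)^α ⟨Δ⟩^β R_h ⟨Δ⟩^γ is bounded on L²,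
uniformly in h ∈ (0,1), for all α, β, γ ∈ ℕ. -/
def OpBounds (l : ℝ) (κ : EuclideanSpace ℝ (Fin n) → EuclideanSpace ℝ (Fin n) → ℝ → ℂ) :
    Prop :=
  ∀ α β γ : ℕ, ∃ C : ℝ, ∀ u : SchwartzMap (EuclideanSpace ℝ (Fin n)) ℂ,
    ∀ h : ℝ, 0 < h → h < 1 →
      eLpNorm (fun x => (h ^ l : ℝ) •
          (hDh n)^[α] (fun h' => japaneseBracket n β
            (kernelOp n κ h' (japaneseBracket n γ (fun y => u y)))) h x) 2 volume
        ≤ ENNReal.ofReal C * eLpNorm (fun x => u x) 2 volume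

/-- Uniform kernel bounds: sup |h^l (h∂_h)^α ∂_x^β ∂_y^γ κ| < ∞ for all orders
(the (x,y)-derivatives encoded through iterated Fréchet derivatives). -/
def KerBounds (l : ℝ) (κ : EuclideanSpace ℝ (Fin n) → EuclideanSpace ℝ (Fin n) → ℝ → ℂ) :
    Prop :=
  ∀ α m : ℕ, ∃ C : ℝ, ∀ h : ℝ, 0 < h → h < 1 →
    ∀ x y : EuclideanSpace ℝ (Fin n),
      h ^ l * ‖iteratedFDeriv ℝ m
        (fun q : EuclideanSpace ℝ (Fin n) × EuclideanSpace ℝ (Fin n) =>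
          (hDhK n)^[α] κ q.1 q.2 h) (x, y)‖ ≤ C

section ResidualKernels

open scoped SchwartzMap LineDeriv Laplacian ContDiff

section Schwartz

variable {E : Type*} [NormedAddCommGroup E] [InnerProductSpace ℝ E] [FiniteDimensional ℝ E]
  [MeasurableSpace E] [BorelSpace E]

/-- The Bessel potential of order `-s` on Schwartz functions, i.e. the Fourier multiplier with
symbol `(1 + ‖ξ‖ ^ 2) ^ (s / 2)`. -/
def bessel (s : ℝ) : 𝓢(E, ℂ) →L[ℂ] 𝓢(E, ℂ) :=
  SchwartzMap.fourierMultiplierCLM ℂ (fun ξ : E => (((1 + ‖ξ‖ ^ 2) ^ (s / 2) : ℝ) : ℂ))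

lemma bessel_zero (f : 𝓢(E, ℂ)) : bessel 0 f = f := by
  simp [bessel]

lemma bessel_bessel (s t : ℝ) (f : 𝓢(E, ℂ)) : bessel s (bessel t f) = bessel (s + t) f := by
  unfold bessel
  rw [SchwartzMap.fourierMultiplierCLM_fourierMultiplierCLM_apply (by fun_prop) (by fun_prop)]
  congr 2
  ext ξ
  simp only [Pi.mul_apply]
  rw [← Complex.ofReal_mul, ← Real.rpow_add (by positivity)]
  congr 2
  ring

lemma bessel_two (f : 𝓢(E, ℂ)) :
    bessel 2 f = f - ((((2 * Real.pi) ^ 2)⁻¹ : ℝ)) • Δ f := by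
  have h1 : bessel 2 f = SchwartzMap.fourierMultiplierCLM ℂ (fun ξ : E => 1 + ‖ξ‖ ^ 2) f := by
    rw [← SchwartzMap.fourierMultiplierCLM_ofReal ℂ (by fun_prop)]
    simp [bessel]
  have h2 : SchwartzMap.fourierMultiplierCLM ℂ (fun ξ : E => 1 + ‖ξ‖ ^ 2) f
      = f + SchwartzMap.fourierMultiplierCLM ℂ (‖·‖ ^ 2 : E → ℝ) f := by
    have := SchwartzMap.fourierMultiplierCLM_sum (ι := Bool) (E := E) (𝕜 := ℝ) ℂ (s := Finset.univ)
      (g := fun i ξ => if i then (1 : ℝ) else ‖ξ‖ ^ 2) (by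
        intro i _
        cases i
        · simp; fun_prop
        · simp)
    simp at this
    rw [this]
    simp
  rw [h1, h2, SchwartzMap.laplacian_eq_fourierMultiplierCLM, smul_smul]
  have : (((2 * Real.pi) ^ 2)⁻¹ : ℝ) * -(2 * Real.pi) ^ 2 = -1 := by
    field_simp
  rw [this]
  simp

lemma norm_toLp_fourierMultiplierCLM_le {a b : E → ℂ} (ha : a.HasTemperateGrowth)
    (hb : b.HasTemperateGrowth) {C : ℝ} (hab : ∀ ξ, ‖a ξ‖ ≤ C * ‖b ξ‖)
    (f : 𝓢(E, ℂ)) :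
    ‖(SchwartzMap.fourierMultiplierCLM ℂ a f).toLp 2‖ ≤
      C * ‖(SchwartzMap.fourierMultiplierCLM ℂ b f).toLp 2‖ := by
  have key : ∀ {a : E → ℂ}, ‖(SchwartzMap.fourierMultiplierCLM ℂ a f).toLp 2‖ =
      ‖(SchwartzMap.smulLeftCLM ℂ a (𝓕 f)).toLp 2‖ := by
    intro a
    rw [← SchwartzMap.norm_fourier_toL2_eq, SchwartzMap.fourierMultiplierCLM_apply,
      FourierTransform.fourier_fourierInv_eq]
  rw [key, key]
  apply Lp.norm_le_mul_norm_of_ae_le_mul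
  filter_upwards [(SchwartzMap.smulLeftCLM ℂ a (𝓕 f)).coeFn_toLp 2 volume,
    (SchwartzMap.smulLeftCLM ℂ b (𝓕 f)).coeFn_toLp 2 volume] with ξ h1 h2
  rw [h1, h2, SchwartzMap.smulLeftCLM_apply_apply ha, SchwartzMap.smulLeftCLM_apply_apply hb,
    norm_smul, norm_smul, ← mul_assoc]
  gcongr
  exact hab ξ

lemma norm_ofReal_rpow_one_add {V : Type*} [SeminormedAddCommGroup V] (ξ : V) (s : ℝ) :
    ‖(((1 + ‖ξ‖ ^ 2) ^ (s / 2) : ℝ) : ℂ)‖ = (1 + ‖ξ‖ ^ 2) ^ (s / 2) := by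
  rw [Complex.norm_real, Real.norm_of_nonneg (by positivity)]

lemma norm_toLp_bessel_le {s t : ℝ} (hst : s ≤ t) (f : 𝓢(E, ℂ)) :
    ‖(bessel s f).toLp 2‖ ≤ ‖(bessel t f).toLp 2‖ := by
  have := norm_toLp_fourierMultiplierCLM_le (E := E)
    (a := fun ξ => (((1 + ‖ξ‖ ^ 2) ^ (s / 2) : ℝ) : ℂ))
    (b := fun ξ => (((1 + ‖ξ‖ ^ 2) ^ (t / 2) : ℝ) : ℂ)) (by fun_prop) (by fun_prop) (C := 1)
    (fun ξ => by
      rw [norm_ofReal_rpow_one_add, norm_ofReal_rpow_one_add, one_mul]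
      exact Real.rpow_le_rpow_of_exponent_le (by nlinarith [sq_nonneg ‖ξ‖]) (by linarith)) f
  simpa [bessel] using this

lemma norm_toLp_bessel_lineDeriv_le (s : ℝ) (e : E) (f : 𝓢(E, ℂ)) :
    ‖(bessel s (∂_{e} f)).toLp 2‖ ≤ 2 * Real.pi * ‖e‖ * ‖(bessel (s + 2) f).toLp 2‖ := by
  have h1 : bessel s (∂_{e} f) = (2 * Real.pi * Complex.I) • SchwartzMap.fourierMultiplierCLM ℂ
      (fun ξ : E => (((1 + ‖ξ‖ ^ 2) ^ (s / 2) * inner ℝ ξ e : ℝ) : ℂ)) f := by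
    rw [SchwartzMap.lineDeriv_eq_fourierMultiplierCLM, map_smul,
      ← SchwartzMap.fourierMultiplierCLM_ofReal ℂ (by fun_prop), bessel,
      SchwartzMap.fourierMultiplierCLM_fourierMultiplierCLM_apply (by fun_prop) (by fun_prop)]
    congr 3
    ext ξ
    simp
  have h2 := norm_toLp_fourierMultiplierCLM_le (E := E)
    (a := fun ξ => (((1 + ‖ξ‖ ^ 2) ^ (s / 2) * inner ℝ ξ e : ℝ) : ℂ))
    (b := fun ξ => (((1 + ‖ξ‖ ^ 2) ^ ((s + 2) / 2) : ℝ) : ℂ)) (by fun_prop) (by fun_prop)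
    (C := ‖e‖) (fun ξ => by
      rw [norm_ofReal_rpow_one_add, Complex.norm_real, norm_mul,
        Real.norm_of_nonneg (by positivity), show (s + 2) / 2 = s / 2 + 1 by ring,
        Real.rpow_add (by positivity), Real.rpow_one]
      have h3 : ‖inner ℝ ξ e‖ ≤ ‖ξ‖ * ‖e‖ := norm_inner_le_norm ξ e
      have h4 : ‖ξ‖ ≤ 1 + ‖ξ‖ ^ 2 := by nlinarith [sq_nonneg (‖ξ‖ - 1)]
      calc _ ≤ (1 + ‖ξ‖ ^ 2) ^ (s / 2) * ((1 + ‖ξ‖ ^ 2) * ‖e‖) := by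
            gcongr
            exact h3.trans (by gcongr)
        _ = _ := by ring) f
  have h5 : (bessel s (∂_{e} f)).toLp 2 = (2 * Real.pi * Complex.I) •
      (SchwartzMap.fourierMultiplierCLM ℂ
        (fun ξ : E => (((1 + ‖ξ‖ ^ 2) ^ (s / 2) * inner ℝ ξ e : ℝ) : ℂ)) f).toLp 2 := by
    rw [h1]
    exact (SchwartzMap.toLpCLM ℂ ℂ 2 volume).map_smul _ _
  rw [h5, norm_smul]
  have h6 : ‖(2 * Real.pi * Complex.I : ℂ)‖ = 2 * Real.pi := by
    simp [abs_of_pos Real.pi_pos]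
  rw [h6]
  exact (mul_le_mul_of_nonneg_left h2 (by positivity)).trans_eq (by rw [bessel]; ring)

lemma integral_mul_bessel_two (f g : 𝓢(E, ℂ)) :
    ∫ x, f x * bessel 2 g x = ∫ x, bessel 2 f x * g x := by
  have hi : ∀ f g : 𝓢(E, ℂ), Integrable (fun x => f x * g x) := fun f g =>
    (SchwartzMap.pairing (ContinuousLinearMap.mul ℂ ℂ) f g).integrable
  simp only [bessel_two, sub_apply, smul_apply, mul_sub, sub_mul,
    mul_smul_comm, smul_mul_assoc]
  rw [integral_sub (hi _ _) ((hi f (Δ g)).fun_smul _),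
    integral_sub (hi _ _) ((hi (Δ f) g).fun_smul _),
    integral_smul, integral_smul, SchwartzMap.integral_mul_laplacian_right_eq_left]

lemma bessel_two_mul_succ (N : ℕ) (f : 𝓢(E, ℂ)) :
    bessel (2 * (N + 1 : ℕ)) f = bessel 2 (bessel (2 * N) f) := by
  rw [bessel_bessel]
  congr 2
  push_cast
  ring

lemma bessel_two_mul_succ' (N : ℕ) (f : 𝓢(E, ℂ)) :
    bessel (2 * (N + 1 : ℕ)) f = bessel (2 * N) (bessel 2 f) := by
  rw [bessel_bessel]
  congr 2
  push_cast
  ring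

lemma integral_mul_bessel (N : ℕ) (f g : 𝓢(E, ℂ)) :
    ∫ x, f x * bessel (2 * N) g x = ∫ x, bessel (2 * N) f x * g x := by
  induction N generalizing f g with
  | zero => simp [bessel_zero]
  | succ N ih =>
    rw [bessel_two_mul_succ', ih, integral_mul_bessel_two, bessel_two_mul_succ]

lemma exists_nat_integrable_rpow (r : ℝ) :
    ∃ N : ℕ, Integrable (fun ξ : E => (1 + ‖ξ‖ ^ 2) ^ (r - N)) := by
  obtain ⟨N, hN⟩ := exists_nat_gt (r + (Module.finrank ℝ E : ℝ) / 2)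
  refine ⟨N, ?_⟩
  have := integrable_rpow_neg_one_add_norm_sq (E := E) (μ := volume) (r := 2 * (N - r))
    (by linarith)
  rwa [show -(2 * (N - r)) / 2 = r - N by ring] at this

/-- Sobolev embedding for Schwartz functions. -/
lemma exists_norm_le_bessel : ∃ N : ℕ, ∃ C : ℝ, 0 ≤ C ∧ ∀ (f : 𝓢(E, ℂ)) (x : E),
    ‖f x‖ ≤ C * ‖(bessel (2 * N) f).toLp 2‖ := by
  obtain ⟨N, hN⟩ := exists_nat_integrable_rpow (E := E) 0
  have hcont : Continuous (fun ξ : E => (1 + ‖ξ‖ ^ 2) ^ (-(N : ℝ))) :=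
    Continuous.rpow_const (by fun_prop) fun ξ => Or.inl (by positivity)
  have hL2 : MemLp (fun ξ : E => (1 + ‖ξ‖ ^ 2) ^ (-(N : ℝ))) 2 := by
    rw [memLp_two_iff_integrable_sq_norm hcont.aestronglyMeasurable]
    refine hN.mono' (hcont.norm.pow 2).aestronglyMeasurable
      (Filter.Eventually.of_forall fun ξ => ?_)
    rw [Real.norm_of_nonneg (by positivity), Real.norm_of_nonneg (by positivity),
      ← Real.rpow_natCast, ← Real.rpow_mul (by positivity)]
    apply Real.rpow_le_rpow_of_exponent_le (by nlinarith [sq_nonneg ‖ξ‖])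
    push_cast
    nlinarith [Nat.cast_nonneg (α := ℝ) N]
  refine ⟨N, ‖hL2.toLp‖, norm_nonneg _, fun f x => ?_⟩
  set g := 𝓕 (bessel (2 * N) f) with hg
  have hgξ : ∀ ξ, ‖𝓕 f ξ‖ = ‖(1 + ‖ξ‖ ^ 2) ^ (-(N : ℝ))‖ * ‖g ξ‖ := by
    intro ξ
    rw [hg, bessel, SchwartzMap.fourierMultiplierCLM_apply,
      FourierTransform.fourier_fourierInv_eq, SchwartzMap.smulLeftCLM_apply_apply (by fun_prop),
      norm_smul, norm_ofReal_rpow_one_add, ← mul_assoc, Real.norm_of_nonneg (by positivity),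
      ← Real.rpow_add (by positivity)]
    simp
  have h1 : ‖f x‖ ≤ ∫ ξ, ‖𝓕 f ξ‖ := by
    have : f x = 𝓕⁻ (𝓕 f) x := by rw [FourierTransform.fourierInv_fourier_eq]
    rw [this, SchwartzMap.fourierInv_coe, Real.fourierInv_eq]
    exact (norm_integral_le_integral_norm _).trans (by simp)
  have h2 := integral_mul_norm_le_Lp_mul_Lq (μ := (volume : Measure E)) (p := 2) (q := 2)
    (by rw [Real.holderConjugate_iff]; norm_num)
    (f := fun ξ => (((1 + ‖ξ‖ ^ 2) ^ (-(N : ℝ)) : ℝ) : ℂ)) (g := g)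
    (by rw [ENNReal.ofReal_ofNat]; exact hL2.ofReal)
    (by rw [ENNReal.ofReal_ofNat]; exact g.memLp 2)
  simp only [Complex.norm_real, ← hgξ] at h2
  refine h1.trans (h2.trans (le_of_eq ?_))
  congr 1
  · rw [Lp.norm_toLp, hL2.eLpNorm_eq_integral_rpow_norm (by simp) (by simp),
      ENNReal.toReal_ofReal (by positivity)]
    simp
  · rw [← SchwartzMap.norm_fourier_toL2_eq, SchwartzMap.norm_toLp' (by simp) (by simp), ← hg]
    simp

/-- Pointwise values of Bessel potentials are integrals against a bounded kernel, after
applying a sufficiently high power of `1 - Δ / (2π)²`. -/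
lemma exists_bessel_apply_eq_integral (s : ℝ) : ∃ N : ℕ, ∀ x : E, ∃ Φ : E → ℂ,
    Continuous Φ ∧ (∃ B, ∀ y, ‖Φ y‖ ≤ B) ∧
    ∀ f : 𝓢(E, ℂ), bessel s f x = ∫ y, Φ y * bessel (2 * N) f y := by
  obtain ⟨N, hN⟩ := exists_nat_integrable_rpow (E := E) (s / 2)
  refine ⟨N, fun x => ?_⟩
  set ψ : E → ℂ := fun ξ => Real.fourierChar (inner ℝ ξ x) • (((1 + ‖ξ‖ ^ 2) ^ (s / 2 - N) : ℝ) : ℂ)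
    with hψ
  have hψn : ∀ ξ, ‖ψ ξ‖ = (1 + ‖ξ‖ ^ 2) ^ (s / 2 - N) := by
    intro ξ
    rw [hψ, Circle.norm_smul, Complex.norm_real, Real.norm_of_nonneg (by positivity)]
  have hψc : Continuous ψ := by
    apply Continuous.smul
    · exact (by fun_prop : Continuous ((↑) : Circle → ℂ)).comp (Real.continuous_fourierChar.comp
        (by fun_prop : Continuous fun ξ : E => inner ℝ ξ x))
    · apply Complex.continuous_ofReal.comp
      refine Continuous.rpow_const (by fun_prop) fun ξ => Or.inl (by positivity)
  have hψi : Integrable ψ := hN.mono' hψc.aestronglyMeasurable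
    (Filter.Eventually.of_forall fun ξ => (hψn ξ).le)
  refine ⟨𝓕 ψ, ?_, ⟨∫ ξ, ‖ψ ξ‖, fun y => ?_⟩, fun f => ?_⟩
  · exact VectorFourier.fourierIntegral_continuous Real.continuous_fourierChar
      continuous_inner hψi
  · exact VectorFourier.norm_fourierIntegral_le_integral_norm _ _ _ _ _
  · have h1 := VectorFourier.integral_fourierIntegral_smul_eq_flip (L := innerₗ E)
      Real.continuous_fourierChar (by simpa using continuous_inner) hψi
      ((bessel (2 * N) f).integrable (μ := volume))
    simp only [smul_eq_mul, flip_innerₗ] at h1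
    refine Eq.trans ?_ h1.symm
    have h2 : bessel s f x = 𝓕⁻ (𝓕 (bessel s f)) x := by
      rw [FourierTransform.fourierInv_fourier_eq]
    rw [h2, SchwartzMap.fourierInv_coe, Real.fourierInv_eq]
    refine integral_congr_ae (Filter.Eventually.of_forall fun ξ => ?_)
    have h3 : VectorFourier.fourierIntegral Real.fourierChar volume (innerₗ E) (bessel (2 * N) f) ξ
      = 𝓕 (bessel (2 * N) f) ξ := rfl
    beta_reduce
    rw [h3]
    simp only [bessel, SchwartzMap.fourierMultiplierCLM_apply]
    rw [FourierTransform.fourier_fourierInv_eq, FourierTransform.fourier_fourierInv_eq,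
      SchwartzMap.smulLeftCLM_apply_apply (by fun_prop),
      SchwartzMap.smulLeftCLM_apply_apply (by fun_prop), hψ]
    simp only [smul_eq_mul, smul_mul_assoc]
    rw [← mul_assoc, ← Complex.ofReal_mul, ← Real.rpow_add (by positivity)]
    congr 4
    ring

lemma norm_toLp_le_of_norm_integral_mul_le {φ : 𝓢(E, ℂ)} (hφ : HasCompactSupport φ) {A : ℝ}
    (hA : 0 ≤ A)
    (h : ∀ u : 𝓢(E, ℂ), HasCompactSupport u → ‖∫ x, φ x * u x‖ ≤ A * ‖u.toLp 2‖) :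
    ‖φ.toLp 2‖ ≤ A := by
  have hc : HasCompactSupport (fun x => (starRingEnd ℂ) (φ x)) :=
    hφ.comp_left (g := starRingEnd ℂ) (map_zero _)
  let u : 𝓢(E, ℂ) := hc.toSchwartzMap (Complex.conjCLE.contDiff.comp (φ.smooth ⊤))
  have hu : ∀ x, u x = (starRingEnd ℂ) (φ x) := fun x => rfl
  have hun : ‖u.toLp 2‖ = ‖φ.toLp 2‖ := by
    rw [SchwartzMap.norm_toLp' (by simp) (by simp), SchwartzMap.norm_toLp' (by simp) (by simp)]
    simp [hu]
  have h1 := h u hc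
  have h2 : ∫ x, φ x * u x = ((‖φ.toLp 2‖ ^ 2 : ℝ) : ℂ) := by
    have := SchwartzMap.inner_toL2_toL2_eq φ φ
    rw [inner_self_eq_norm_sq_to_K] at this
    rw [Complex.ofReal_pow]
    exact (this.trans (by simp [hu, Complex.mul_conj'])).symm
  rw [h2, hun, Complex.norm_real, norm_pow, norm_norm] at h1
  rcases (norm_nonneg (φ.toLp 2)).eq_or_lt with h0 | h0
  · rwa [← h0]
  · nlinarith

end Schwartz

section Kernel

/-- The domain of smoothness of an `h`-dependent integral kernel. -/
def kernelDomain (E : Type*) : Set (E × E × ℝ) := Set.univ ×ˢ Set.univ ×ˢ Set.Ioo (0 : ℝ) 1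

lemma mem_kernelDomain {E : Type*} {p : E × E × ℝ} :
    p ∈ kernelDomain E ↔ 0 < p.2.2 ∧ p.2.2 < 1 := by
  simp [kernelDomain]

lemma isOpen_kernelDomain {E : Type*} [TopologicalSpace E] : IsOpen (kernelDomain E) :=
  isOpen_univ.prod (isOpen_univ.prod isOpen_Ioo)

lemma add_smul_sum_induction {X : Type*} {P : (X → ℂ) → Prop}
    (hP : ∀ F G, P F → P G → ∀ c : ℝ, P (F + c • G)) {ι : Type*} (s : Finset ι)
    {F : X → ℂ} (hF : P F) {G : ι → X → ℂ} (hG : ∀ i, P (G i)) (c : ℝ) :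
    P (F + c • ∑ i ∈ s, G i) := by
  classical
  induction s using Finset.induction with
  | empty => simpa using hF
  | insert i s hi ih =>
    rw [Finset.sum_insert hi, smul_add, add_comm (c • G i), ← add_assoc]
    exact hP _ _ ih (hG i) c

variable {E : Type*} [NormedAddCommGroup E] [InnerProductSpace ℝ E]

/-- Smooth properly supported `h`-dependent kernels. -/
structure IsProperKernel (F : E × E × ℝ → ℂ) : Prop where
  contDiffOn : ContDiffOn ℝ ∞ F (kernelDomain E)
  eq_zero : ∃ M : ℝ, ∀ p : E × E × ℝ, M < ‖p.1 - p.2.1‖ → F p = 0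

/-- The derivative of a kernel along the vector field `w.1 ∂_x + w.2.1 ∂_y + w.2.2 h ∂_h`. -/
def kernelDeriv (w : E × E × ℝ) (F : E × E × ℝ → ℂ) : E × E × ℝ → ℂ :=
  fun p => fderiv ℝ F p (w.1, w.2.1, p.2.2 * w.2.2)

lemma kernelDeriv_congr {F G : E × E × ℝ → ℂ} (h : Set.EqOn F G (kernelDomain E))
    (w : E × E × ℝ) : Set.EqOn (kernelDeriv w F) (kernelDeriv w G) (kernelDomain E) := by
  intro p hp
  simp only [kernelDeriv, (h.eventuallyEq_of_mem (isOpen_kernelDomain.mem_nhds hp)).fderiv_eq]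

lemma IsProperKernel.contDiffAt {F : E × E × ℝ → ℂ} (hF : IsProperKernel F) {p : E × E × ℝ}
    (hp : p ∈ kernelDomain E) : ContDiffAt ℝ ∞ F p :=
  hF.contDiffOn.contDiffAt (isOpen_kernelDomain.mem_nhds hp)

lemma IsProperKernel.differentiableAt {F : E × E × ℝ → ℂ} (hF : IsProperKernel F)
    {p : E × E × ℝ} (hp : p ∈ kernelDomain E) : DifferentiableAt ℝ F p :=
  (hF.contDiffAt hp).differentiableAt (by simp)

lemma IsProperKernel.kernelDeriv {F : E × E × ℝ → ℂ} (hF : IsProperKernel F) (w : E × E × ℝ) :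
    IsProperKernel (kernelDeriv w F) := by
  refine ⟨?_, ?_⟩
  · exact (hF.contDiffOn.fderiv_of_isOpen isOpen_kernelDomain (by simp)).clm_apply
      (ContDiff.contDiffOn (by fun_prop))
  · obtain ⟨M, hM⟩ := hF.eq_zero
    refine ⟨M, fun p hp => ?_⟩
    have : F =ᶠ[nhds p] fun _ => 0 := by
      have ho : IsOpen {p : E × E × ℝ | M < ‖p.1 - p.2.1‖} :=
        isOpen_lt continuous_const (by fun_prop)
      filter_upwards [ho.mem_nhds hp] with q hq using hM q hq
    simp [_root_.kernelDeriv, this.fderiv_eq]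

lemma IsProperKernel.add_smul {F G : E × E × ℝ → ℂ} (hF : IsProperKernel F)
    (hG : IsProperKernel G) (c : ℝ) : IsProperKernel (F + c • G) := by
  refine ⟨hF.contDiffOn.add (hG.contDiffOn.const_smul c), ?_⟩
  obtain ⟨M, hM⟩ := hF.eq_zero
  obtain ⟨M', hM'⟩ := hG.eq_zero
  refine ⟨max M M', fun p hp => ?_⟩
  simp [hM p ((le_max_left _ _).trans_lt hp), hM' p ((le_max_right _ _).trans_lt hp)]

lemma kernelDeriv_add_smul {F G : E × E × ℝ → ℂ} (hF : IsProperKernel F)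
    (hG : IsProperKernel G) (c : ℝ) (w : E × E × ℝ) :
    Set.EqOn (kernelDeriv w (F + c • G)) (kernelDeriv w F + c • kernelDeriv w G)
      (kernelDomain E) := by
  intro p hp
  simp only [kernelDeriv, Pi.add_apply, Pi.smul_apply]
  rw [fderiv_add (hF.differentiableAt hp) ((hG.differentiableAt hp).const_smul c),
    fderiv_const_smul (hG.differentiableAt hp)]
  simp

lemma kernelDeriv_comm {F : E × E × ℝ → ℂ} (hF : IsProperKernel F) (w w' : E × E × ℝ) :
    Set.EqOn (kernelDeriv w (kernelDeriv w' F)) (kernelDeriv w' (kernelDeriv w F))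
      (kernelDomain E) := by
  intro p hp
  have hsymm : IsSymmSndFDerivAt ℝ F p := (hF.contDiffAt hp).isSymmSndFDerivAt
    (by simp only [minSmoothness_of_isRCLikeNormedField]; exact WithTop.coe_le_coe.2 le_top)
  have hd : DifferentiableAt ℝ (fderiv ℝ F) p :=
    ((hF.contDiffAt hp).fderiv_right (m := 1)
      (WithTop.coe_le_coe.2 le_top)).differentiableAt (by simp)
  have key : ∀ w w' : E × E × ℝ, kernelDeriv w (kernelDeriv w' F) p =
      fderiv ℝ (fderiv ℝ F) p (w.1, w.2.1, p.2.2 * w.2.2) (w'.1, w'.2.1, p.2.2 * w'.2.2) +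
      (w.2.2 * w'.2.2 * p.2.2) • fderiv ℝ F p (0, 0, 1) := by
    intro w w'
    have hv : HasFDerivAt (fun q : E × E × ℝ => (w'.1, w'.2.1, q.2.2 * w'.2.2))
        ((0 : E × E × ℝ →L[ℝ] E).prod ((0 : E × E × ℝ →L[ℝ] E).prod
          (w'.2.2 • ((ContinuousLinearMap.snd ℝ E ℝ).comp
            (ContinuousLinearMap.snd ℝ E (E × ℝ)))))) p := by
      refine (hasFDerivAt_const _ _).prodMk ((hasFDerivAt_const _ _).prodMk ?_)
      exact (hasFDerivAt_snd.comp p hasFDerivAt_snd).mul_const w'.2.2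
    have h1 := (hd.hasFDerivAt.clm_apply hv).fderiv
    unfold kernelDeriv
    rw [h1]
    have h2 : ((0 : E), (0 : E), w'.2.2 * (p.2.2 * w.2.2)) =
        (w.2.2 * w'.2.2 * p.2.2) • ((0 : E), (0 : E), (1 : ℝ)) := by
      ext <;> simp
      ring
    simp only [add_apply, ContinuousLinearMap.comp_apply, ContinuousLinearMap.prod_apply,
      ContinuousLinearMap.flip_apply, zero_apply, smul_apply,
      ContinuousLinearMap.coe_snd', smul_eq_mul]
    rw [h2, map_smul, add_comm]
  rw [key, key, hsymm.eq, mul_comm w.2.2]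

lemma kernelDeriv_eq_add_smul (F : E × E × ℝ → ℂ) (a b : E) (c : ℝ) :
    kernelDeriv (a, b, c) F = kernelDeriv (a, b, 0) F + c • kernelDeriv (0, 0, 1) F := by
  ext p
  simp only [kernelDeriv, Pi.add_apply, Pi.smul_apply]
  rw [← map_smul, ← map_add]
  congr 1
  simp [mul_comm]

lemma IsProperKernel.iterate_kernelDeriv {F : E × E × ℝ → ℂ} (hF : IsProperKernel F)
    (w : E × E × ℝ) (k : ℕ) : IsProperKernel ((_root_.kernelDeriv w)^[k] F) := by
  induction k with
  | zero => exact hF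
  | succ k ih =>
    rw [Function.iterate_succ_apply']
    exact ih.kernelDeriv w

lemma iterate_kernelDeriv_comm {F : E × E × ℝ → ℂ} (hF : IsProperKernel F) (w w' : E × E × ℝ)
    (k : ℕ) :
    Set.EqOn ((kernelDeriv w)^[k] (kernelDeriv w' F)) (kernelDeriv w' ((kernelDeriv w)^[k] F))
      (kernelDomain E) := by
  induction k with
  | zero => exact fun _ _ => rfl
  | succ k ih =>
    rw [Function.iterate_succ_apply', Function.iterate_succ_apply']
    exact (kernelDeriv_congr ih w).trans (kernelDeriv_comm (hF.iterate_kernelDeriv w k) w w')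

lemma iterate_kernelDeriv_add_smul {F G : E × E × ℝ → ℂ} (hF : IsProperKernel F)
    (hG : IsProperKernel G) (c : ℝ) (w : E × E × ℝ) (k : ℕ) :
    Set.EqOn ((kernelDeriv w)^[k] (F + c • G))
      ((kernelDeriv w)^[k] F + c • (kernelDeriv w)^[k] G) (kernelDomain E) := by
  induction k with
  | zero => exact fun _ _ => rfl
  | succ k ih =>
    simp only [Function.iterate_succ_apply']
    exact (kernelDeriv_congr ih w).trans
      (kernelDeriv_add_smul (hF.iterate_kernelDeriv w k) (hG.iterate_kernelDeriv w k) c w)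

/-- The constant coefficient operator `1 - (2π)⁻² ∑ᵢ wᵢ²` in terms of vector fields `wᵢ`. -/
def kernelLaplace {ι : Type*} [Fintype ι] (w : ι → E × E × ℝ) (F : E × E × ℝ → ℂ) :
    E × E × ℝ → ℂ :=
  F + (-((2 * Real.pi) ^ 2)⁻¹ : ℝ) • ∑ i, kernelDeriv (w i) (kernelDeriv (w i) F)

lemma IsProperKernel.kernelLaplace {F : E × E × ℝ → ℂ} (hF : IsProperKernel F)
    {ι : Type*} [Fintype ι] (w : ι → E × E × ℝ) : IsProperKernel (kernelLaplace w F) :=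
  add_smul_sum_induction (fun _ _ h h' c => h.add_smul h' c) _ hF
    (fun i => (hF.kernelDeriv (w i)).kernelDeriv (w i)) _

lemma kernelLaplace_congr {F G : E × E × ℝ → ℂ} (h : Set.EqOn F G (kernelDomain E))
    {ι : Type*} [Fintype ι] (w : ι → E × E × ℝ) :
    Set.EqOn (kernelLaplace w F) (kernelLaplace w G) (kernelDomain E) := by
  intro p hp
  simp only [kernelLaplace, Pi.add_apply, Pi.smul_apply, Finset.sum_apply, h hp,
    kernelDeriv_congr (kernelDeriv_congr h _) _ hp]

lemma kernelDeriv_add_smul_sum {ι : Type*} (s : Finset ι) {F : E × E × ℝ → ℂ}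
    (hF : IsProperKernel F) {G : ι → E × E × ℝ → ℂ} (hG : ∀ i, IsProperKernel (G i)) (c : ℝ)
    (w : E × E × ℝ) :
    Set.EqOn (kernelDeriv w (F + c • ∑ i ∈ s, G i))
      (kernelDeriv w F + c • ∑ i ∈ s, kernelDeriv w (G i)) (kernelDomain E) := by
  classical
  induction s using Finset.induction with
  | empty => simpa using Set.eqOn_refl _ _
  | insert i s hi ih =>
    rw [Finset.sum_insert hi, Finset.sum_insert hi, smul_add, smul_add, add_comm (c • G i),
      add_comm (c • kernelDeriv w (G i)), ← add_assoc, ← add_assoc]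
    refine (kernelDeriv_add_smul
      (add_smul_sum_induction (fun _ _ h h' c => h.add_smul h' c) s hF hG c) (hG i) c w).trans ?_
    intro p hp
    simp only [Pi.add_apply, ih hp]

lemma kernelLaplace_kernelDeriv {F : E × E × ℝ → ℂ} (hF : IsProperKernel F)
    {ι : Type*} [Fintype ι] (w : ι → E × E × ℝ) (w' : E × E × ℝ) :
    Set.EqOn (kernelLaplace w (kernelDeriv w' F)) (kernelDeriv w' (kernelLaplace w F))
      (kernelDomain E) := by
  refine Set.EqOn.trans ?_ (kernelDeriv_add_smul_sum _ hF
    (fun i => (hF.kernelDeriv (w i)).kernelDeriv (w i)) _ w').symm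
  intro p hp
  simp only [kernelLaplace, Pi.add_apply, Pi.smul_apply, Finset.sum_apply]
  congr 2
  refine Finset.sum_congr rfl fun i _ => ?_
  rw [kernelDeriv_congr (kernelDeriv_comm hF (w i) w') _ hp,
    kernelDeriv_comm (hF.kernelDeriv _) (w i) w' hp]

lemma IsProperKernel.iterate_kernelLaplace {F : E × E × ℝ → ℂ} (hF : IsProperKernel F)
    {ι : Type*} [Fintype ι] (w : ι → E × E × ℝ) (k : ℕ) :
    IsProperKernel ((_root_.kernelLaplace w)^[k] F) := by
  induction k with
  | zero => exact hF
  | succ k ih =>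
    rw [Function.iterate_succ_apply']
    exact ih.kernelLaplace w

lemma iterate_kernelLaplace_kernelDeriv {F : E × E × ℝ → ℂ} (hF : IsProperKernel F)
    {ι : Type*} [Fintype ι] (w : ι → E × E × ℝ) (w' : E × E × ℝ) (k : ℕ) :
    Set.EqOn ((kernelLaplace w)^[k] (kernelDeriv w' F))
      (kernelDeriv w' ((kernelLaplace w)^[k] F)) (kernelDomain E) := by
  induction k with
  | zero => exact fun _ _ => rfl
  | succ k ih =>
    rw [Function.iterate_succ_apply', Function.iterate_succ_apply']
    exact (kernelLaplace_congr ih w).trans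
      (kernelLaplace_kernelDeriv (hF.iterate_kernelLaplace w k) w w')

end Kernel

section KernelIntegral

/-- The operator with kernel `F (·, ·, h)`. -/
def kernelIntegral {E : Type*} [MeasureSpace E] (F : E × E × ℝ → ℂ) (h : ℝ) (v : E → ℂ) (x : E) :
    ℂ :=
  ∫ y, F (x, y, h) * v y

lemma mk_mem_kernelDomain {E : Type*} {h : ℝ} (hh : h ∈ Set.Ioo (0 : ℝ) 1) (x y : E) :
    (x, y, h) ∈ kernelDomain E := mem_kernelDomain.2 hh

lemma kernelIntegral_congr {E : Type*} [MeasureSpace E] {F G : E × E × ℝ → ℂ}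
    (hFG : Set.EqOn F G (kernelDomain E)) {h : ℝ} (hh : h ∈ Set.Ioo (0 : ℝ) 1) (v : E → ℂ)
    (x : E) : kernelIntegral F h v x = kernelIntegral G h v x := by
  simp only [kernelIntegral, hFG (mk_mem_kernelDomain hh _ _)]

variable {E : Type*} [NormedAddCommGroup E] [InnerProductSpace ℝ E]

lemma IsProperKernel.contDiff_slice {F : E × E × ℝ → ℂ} (hF : IsProperKernel F) {h : ℝ}
    (hh : h ∈ Set.Ioo (0 : ℝ) 1) : ContDiff ℝ ∞ (fun q : E × E => F (q.1, q.2, h)) :=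
  hF.contDiffOn.comp_contDiff (by fun_prop) fun q => mk_mem_kernelDomain hh _ _

lemma IsProperKernel.fderiv_slice {F : E × E × ℝ → ℂ} (hF : IsProperKernel F) {h : ℝ}
    (hh : h ∈ Set.Ioo (0 : ℝ) 1) (q w : E × E) :
    fderiv ℝ (fun q : E × E => F (q.1, q.2, h)) q w
      = _root_.kernelDeriv (w.1, w.2, 0) F (q.1, q.2, h) := by
  have h1 : HasFDerivAt (fun q : E × E => (q.1, q.2, h))
      ((ContinuousLinearMap.fst ℝ E E).prod ((ContinuousLinearMap.snd ℝ E E).prod 0)) q :=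
    hasFDerivAt_fst.prodMk (hasFDerivAt_snd.prodMk (hasFDerivAt_const _ _))
  have h2 := ((hF.differentiableAt (mk_mem_kernelDomain hh q.1 q.2)).hasFDerivAt.comp q h1).fderiv
  simp only [Function.comp_def] at h2
  rw [h2]
  simp [_root_.kernelDeriv]

lemma IsProperKernel.fderiv_slice_right {F : E × E × ℝ → ℂ} (hF : IsProperKernel F) {h : ℝ}
    (hh : h ∈ Set.Ioo (0 : ℝ) 1) (x y e : E) :
    fderiv ℝ (fun y => F (x, y, h)) y e = _root_.kernelDeriv (0, e, 0) F (x, y, h) := by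
  rw [← hF.fderiv_slice hh (x, y) (0, e)]
  have h1 : HasFDerivAt (fun y : E => (x, y))
      ((0 : E →L[ℝ] E).prod (ContinuousLinearMap.id ℝ E)) y :=
    (hasFDerivAt_const _ _).prodMk (hasFDerivAt_id _)
  have h2 := ((((hF.contDiff_slice hh).differentiable (by simp)) (x, y)).hasFDerivAt.comp y
    h1).fderiv
  exact (DFunLike.congr_fun h2 e).trans (by simp)

lemma IsProperKernel.deriv_param {F : E × E × ℝ → ℂ} (hF : IsProperKernel F) {h : ℝ}
    (hh : h ∈ Set.Ioo (0 : ℝ) 1) (x y : E) :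
    h * deriv (fun h' => F (x, y, h')) h = _root_.kernelDeriv (0, 0, 1) F (x, y, h) := by
  have h1 : HasDerivAt (fun h' : ℝ => (x, y, h')) ((0 : E), (0 : E), (1 : ℝ)) h :=
    (hasDerivAt_const _ _).prodMk ((hasDerivAt_const _ _).prodMk (hasDerivAt_id _))
  have h2 := ((hF.differentiableAt (mk_mem_kernelDomain hh x y)).hasFDerivAt.comp_hasDerivAt h
    h1).deriv
  simp only [Function.comp_def] at h2
  rw [h2, _root_.kernelDeriv]
  have h3 : ((0 : E), (0 : E), h * 1) = h • ((0 : E), (0 : E), (1 : ℝ)) := by simp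
  simp only [h3, map_smul, Complex.real_smul]

lemma contDiffOn_shear {F : E × E × ℝ → ℂ} (hF : IsProperKernel F) :
    ContDiffOn ℝ ∞ (fun q : (E × ℝ) × E => F (q.1.1, q.1.1 - q.2, q.1.2))
      ((Set.univ ×ˢ Set.Ioo (0 : ℝ) 1) ×ˢ Set.univ) :=
  hF.contDiffOn.comp (ContDiff.contDiffOn (by fun_prop))
    fun q hq => mk_mem_kernelDomain hq.1.2 _ _

variable [FiniteDimensional ℝ E]

lemma IsProperKernel.hasCompactSupport_right {F : E × E × ℝ → ℂ} (hF : IsProperKernel F)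
    (x : E) (h : ℝ) : HasCompactSupport (fun y => F (x, y, h)) := by
  obtain ⟨M, hM⟩ := hF.eq_zero
  refine HasCompactSupport.intro (isCompact_closedBall x M) fun y hy => hM _ ?_
  simpa [dist_eq_norm, norm_sub_rev] using hy

/-- The kernel as a Schwartz function of the second variable. -/
def IsProperKernel.slice {F : E × E × ℝ → ℂ} (hF : IsProperKernel F) {h : ℝ}
    (hh : h ∈ Set.Ioo (0 : ℝ) 1) (x : E) : 𝓢(E, ℂ) :=
  (hF.hasCompactSupport_right x h).toSchwartzMap
    ((hF.contDiff_slice hh).comp (contDiff_const.prodMk contDiff_id))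

lemma IsProperKernel.hasCompactSupport_slice {F : E × E × ℝ → ℂ} (hF : IsProperKernel F) {h : ℝ}
    (hh : h ∈ Set.Ioo (0 : ℝ) 1) (x : E) : HasCompactSupport (hF.slice hh x) :=
  hF.hasCompactSupport_right x h

lemma exists_isCompact_shear {F : E × E × ℝ → ℂ} (hF : IsProperKernel F) :
    ∃ k : Set E, IsCompact k ∧ ∀ p : E × ℝ, ∀ z, p ∈ Set.univ ×ˢ Set.Ioo (0 : ℝ) 1 → z ∉ k →
      F (p.1, p.1 - z, p.2) = 0 := by
  obtain ⟨M, hM⟩ := hF.eq_zero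
  refine ⟨Metric.closedBall 0 M, isCompact_closedBall _ _, fun p z _ hz => hM _ ?_⟩
  simpa using hz

variable [MeasurableSpace E] [BorelSpace E]

lemma IsProperKernel.integrable_mul {F : E × E × ℝ → ℂ} (hF : IsProperKernel F) {h : ℝ}
    (hh : h ∈ Set.Ioo (0 : ℝ) 1) {v : E → ℂ} (hv : Continuous v) (x : E) :
    Integrable (fun y => F (x, y, h) * v y) :=
  Continuous.integrable_of_hasCompactSupport ((hF.slice hh x).continuous.mul hv)
    (hF.hasCompactSupport_slice hh x).mul_right

lemma kernelIntegral_add_smul {F G : E × E × ℝ → ℂ} (hF : IsProperKernel F)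
    (hG : IsProperKernel G) (c : ℝ) {h : ℝ} (hh : h ∈ Set.Ioo (0 : ℝ) 1) {v : E → ℂ}
    (hv : Continuous v) (x : E) :
    kernelIntegral (F + c • G) h v x = kernelIntegral F h v x + c • kernelIntegral G h v x := by
  simp only [kernelIntegral, Pi.add_apply, Pi.smul_apply, add_mul, smul_mul_assoc]
  rw [← integral_smul]
  exact integral_add (hF.integrable_mul hh hv x) ((hG.integrable_mul hh hv x).smul c)

lemma kernelIntegral_eq_convolution (F : E × E × ℝ → ℂ) (h : ℝ) (v : E → ℂ) (x : E) :
    kernelIntegral F h v x = convolution v (fun z => F (x, x - z, h))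
      (ContinuousLinearMap.mul ℝ ℂ) volume x := by
  simp [kernelIntegral, convolution, mul_comm]

lemma IsProperKernel.contDiffOn_kernelIntegral {F : E × E × ℝ → ℂ} (hF : IsProperKernel F)
    {v : E → ℂ} (hv : Continuous v) :
    ContDiffOn ℝ ∞ (fun p : E × ℝ => kernelIntegral F p.2 v p.1)
      (Set.univ ×ˢ Set.Ioo (0 : ℝ) 1) := by
  obtain ⟨k, hk, hk0⟩ := exists_isCompact_shear hF
  have h1 := contDiffOn_convolution_right_with_param (μ := volume) (n := ⊤)
    (ContinuousLinearMap.mul ℝ ℂ) (g := fun (p : E × ℝ) z => F (p.1, p.1 - z, p.2))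
    (isOpen_univ.prod isOpen_Ioo) hk hk0 hv.locallyIntegrable (contDiffOn_shear hF)
  have h2 : ContDiff ℝ ∞ (fun p : E × ℝ => (p, p.1)) := by fun_prop
  simp only [kernelIntegral_eq_convolution]
  exact h1.comp h2.contDiffOn fun p hp => ⟨hp, Set.mem_univ _⟩

lemma IsProperKernel.fderiv_kernelIntegral {F : E × E × ℝ → ℂ} (hF : IsProperKernel F)
    {v : E → ℂ} (hv : Continuous v) {h : ℝ} (hh : h ∈ Set.Ioo (0 : ℝ) 1) (x e : E) (c : ℝ) :
    fderiv ℝ (fun p : E × ℝ => kernelIntegral F p.2 v p.1) (x, h) (e, h * c) =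
      kernelIntegral (_root_.kernelDeriv (e, 0, c) F) h v x := by
  obtain ⟨k, hk, hk0⟩ := exists_isCompact_shear hF
  let g : E × ℝ → E → ℂ := fun p z => F (p.1, p.1 - z, p.2)
  have hs : IsOpen ((Set.univ : Set E) ×ˢ Set.Ioo (0 : ℝ) 1) := isOpen_univ.prod isOpen_Ioo
  have hmem : (x, h) ∈ (Set.univ : Set E) ×ˢ Set.Ioo (0 : ℝ) 1 := ⟨Set.mem_univ _, hh⟩
  have h1 := hasFDerivAt_convolution_right_with_param (μ := volume)
    (ContinuousLinearMap.mul ℝ ℂ) (g := g) hs hk hk0 hv.locallyIntegrable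
    ((contDiffOn_shear hF).of_le (by simp)) ((x, h), x) hmem
  have h2 : HasFDerivAt (fun p : E × ℝ => (p, p.1))
      ((ContinuousLinearMap.id ℝ (E × ℝ)).prod (ContinuousLinearMap.fst ℝ E ℝ)) (x, h) :=
    (hasFDerivAt_id _).prodMk hasFDerivAt_fst
  have h3 := (HasFDerivAt.comp (x, h) h1 h2).fderiv
  simp only [kernelIntegral_eq_convolution]
  simp only [Function.comp_def, g] at h3
  rw [h3, ContinuousLinearMap.comp_apply, ContinuousLinearMap.prod_apply]
  have hc : Continuous fun z : E => fderiv ℝ ↿g ((x, h), z) :=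
    ((contDiffOn_shear hF).continuousOn_fderiv_of_isOpen (hs.prod isOpen_univ)
      (by simp)).comp_continuous (by fun_prop) fun z => ⟨hmem, Set.mem_univ _⟩
  have hcs : HasCompactSupport fun z : E => fderiv ℝ ↿g ((x, h), z) := by
    refine HasCompactSupport.intro hk fun z hz => ?_
    refine (hasFDerivAt_zero_of_eventually_const 0 ?_).fderiv
    filter_upwards [(hs.prod hk.isClosed.isOpen_compl).mem_nhds
      (show ((x, h), z) ∈ _ from ⟨hmem, hz⟩)] with q hq using hk0 _ _ hq.1 hq.2
  have h4 := convolution_precompR_apply (μ := volume) (ContinuousLinearMap.mul ℝ ℂ)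
    hv.locallyIntegrable hcs hc x ((e, h * c), e)
  refine h4.trans ?_
  refine integral_congr_ae (Filter.Eventually.of_forall fun y => ?_)
  simp only [ContinuousLinearMap.mul_apply']
  congr 1
  let A : (E × ℝ) × E →L[ℝ] E × E × ℝ :=
    ((ContinuousLinearMap.fst ℝ E ℝ).comp (ContinuousLinearMap.fst ℝ (E × ℝ) E)).prod
      ((((ContinuousLinearMap.fst ℝ E ℝ).comp (ContinuousLinearMap.fst ℝ (E × ℝ) E)) -
        ContinuousLinearMap.snd ℝ (E × ℝ) E).prod
      ((ContinuousLinearMap.snd ℝ E ℝ).comp (ContinuousLinearMap.fst ℝ (E × ℝ) E)))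
  have h5 := (HasFDerivAt.comp ((x, h), x - y) (g := F) (hF.differentiableAt
    (mk_mem_kernelDomain hh x (x - (x - y)))).hasFDerivAt
    (A.hasFDerivAt (x := ((x, h), x - y)))).fderiv
  have h6 : ↿g = F ∘ A := rfl
  rw [h6, h5]
  simp [_root_.kernelDeriv, A]

lemma IsProperKernel.contDiff_kernelIntegral {F : E × E × ℝ → ℂ} (hF : IsProperKernel F)
    {v : E → ℂ} (hv : Continuous v) {h : ℝ} (hh : h ∈ Set.Ioo (0 : ℝ) 1) :
    ContDiff ℝ ∞ (kernelIntegral F h v) :=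
  (hF.contDiffOn_kernelIntegral hv).comp_contDiff (contDiff_id.prodMk contDiff_const)
    fun _ => ⟨Set.mem_univ _, hh⟩

lemma IsProperKernel.differentiableAt_kernelIntegral {F : E × E × ℝ → ℂ}
    (hF : IsProperKernel F) {v : E → ℂ} (hv : Continuous v) {h : ℝ}
    (hh : h ∈ Set.Ioo (0 : ℝ) 1) (x : E) :
    DifferentiableAt ℝ (fun p : E × ℝ => kernelIntegral F p.2 v p.1) (x, h) :=
  ((hF.contDiffOn_kernelIntegral hv).contDiffAt
    ((isOpen_univ.prod isOpen_Ioo).mem_nhds ⟨Set.mem_univ _, hh⟩)).differentiableAt (by simp)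

lemma IsProperKernel.fderiv_kernelIntegral_left {F : E × E × ℝ → ℂ} (hF : IsProperKernel F)
    {v : E → ℂ} (hv : Continuous v) {h : ℝ} (hh : h ∈ Set.Ioo (0 : ℝ) 1) (x e : E) :
    fderiv ℝ (kernelIntegral F h v) x e =
      kernelIntegral (_root_.kernelDeriv (e, 0, 0) F) h v x := by
  rw [← hF.fderiv_kernelIntegral hv hh x e 0]
  have h1 : HasFDerivAt (fun x : E => (x, h)) ((ContinuousLinearMap.id ℝ E).prod 0) x :=
    (hasFDerivAt_id _).prodMk (hasFDerivAt_const _ _)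
  have h2 := ((hF.differentiableAt_kernelIntegral hv hh x).hasFDerivAt.comp x h1).fderiv
  simp only [Function.comp_def] at h2
  exact (DFunLike.congr_fun h2 e).trans (by simp)

lemma IsProperKernel.hasDerivAt_kernelIntegral {F : E × E × ℝ → ℂ} (hF : IsProperKernel F)
    {v : E → ℂ} (hv : Continuous v) {h : ℝ} (hh : h ∈ Set.Ioo (0 : ℝ) 1) (x : E) :
    HasDerivAt (fun h' => kernelIntegral F h' v x)
      (h⁻¹ * kernelIntegral (_root_.kernelDeriv (0, 0, 1) F) h v x) h := by
  have h1 : HasDerivAt (fun h' : ℝ => (x, h')) ((0 : E), (1 : ℝ)) h :=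
    (hasDerivAt_const _ _).prodMk (hasDerivAt_id _)
  have h2 := (hF.differentiableAt_kernelIntegral hv hh x).hasFDerivAt.comp_hasDerivAt h h1
  convert! h2 using 1
  rw [← hF.fderiv_kernelIntegral hv hh x 0 1]
  have h3 : ((0 : E), h * 1) = h • ((0 : E), (1 : ℝ)) := by simp
  have h0 : (h : ℂ) ≠ 0 := by exact_mod_cast hh.1.ne'
  rw [h3, map_smul, Complex.real_smul, Complex.ofReal_inv, inv_mul_cancel_left₀ h0]

end KernelIntegral

lemma exists_norm_iteratedFDeriv_bound {ι κ V : Type*} [Fintype κ] [NormedAddCommGroup V]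
    [NormedSpace ℝ V] [FiniteDimensional ℝ V] (b : Module.Basis κ ℝ V)
    {P : (ι → V → ℂ) → Prop} {ρ : ι → V → ℝ} (hr : ∀ i p, 0 ≤ ρ i p)
    (hP : ∀ f, P f → ∀ i, ContDiff ℝ ∞ (f i))
    (hd : ∀ f, P f → ∀ j, P fun i p => fderiv ℝ (f i) p (b j))
    (hb : ∀ f, P f → ∃ C, ∀ i p, ρ i p * ‖f i p‖ ≤ C) (m : ℕ) :
    ∀ f, P f → ∃ C, ∀ i p, ρ i p * ‖iteratedFDeriv ℝ m (f i) p‖ ≤ C := by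
  induction m with
  | zero => simpa only [norm_iteratedFDeriv_zero] using hb
  | succ m ih =>
    intro f hf
    choose C hC using fun j => ih _ (hd f hf j)
    let A : κ → ℂ →L[ℝ] V →L[ℝ] ℂ := fun j =>
      ContinuousLinearMap.smulRightL ℝ V ℂ (LinearMap.toContinuousLinearMap (b.coord j))
    refine ⟨∑ j, ‖A j‖ * C j, fun i p => ?_⟩
    have h1 : fderiv ℝ (f i) = fun p => ∑ j, (A j ∘ fun p => fderiv ℝ (f i) p (b j)) p := by
      ext p v
      conv_lhs => rw [← b.sum_repr v, map_sum]
      simp [A]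
    have hs : ∀ j, ContDiff ℝ ∞ fun p => fderiv ℝ (f i) p (b j) := fun j => hP _ (hd f hf j) i
    have hle : (m : WithTop ℕ∞) ≤ ((⊤ : ℕ∞) : WithTop ℕ∞) := WithTop.coe_le_coe.2 le_top
    rw [← norm_iteratedFDeriv_fderiv, h1, iteratedFDeriv_fun_sum_apply
      fun j _ => ((A j).contDiff.comp ((hs j).of_le hle)).contDiffAt]
    refine (mul_le_mul_of_nonneg_left (norm_sum_le _ _) (hr i p)).trans ?_
    rw [Finset.mul_sum]
    refine Finset.sum_le_sum fun j _ => ?_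
    calc ρ i p * ‖iteratedFDeriv ℝ m (A j ∘ fun p => fderiv ℝ (f i) p (b j)) p‖
        ≤ ρ i p * (‖A j‖ * ‖iteratedFDeriv ℝ m (fun p => fderiv ℝ (f i) p (b j)) p‖) :=
          mul_le_mul_of_nonneg_left
            ((A j).norm_iteratedFDeriv_comp_left (hs j).contDiffAt hle) (hr i p)
      _ = ‖A j‖ * (ρ i p * ‖iteratedFDeriv ℝ m (fun p => fderiv ℝ (f i) p (b j)) p‖) := by ring
      _ ≤ ‖A j‖ * C j := mul_le_mul_of_nonneg_left (hC j i p) (norm_nonneg (A j))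

section KernelClass

variable {E : Type*} [NormedAddCommGroup E] [InnerProductSpace ℝ E]

/-- A class of properly supported kernels, stable under linear combinations and derivatives, all of
whose members are bounded on `{y ∈ S}`, locally uniformly in `h`. -/
structure IsKernelClass (S : Set E) (P : (E × E × ℝ → ℂ) → Prop) : Prop where
  isProperKernel : ∀ {F}, P F → IsProperKernel F
  kernelDeriv : ∀ {F}, P F → ∀ w, P (kernelDeriv w F)
  add_smul : ∀ {F G}, P F → P G → ∀ c : ℝ, P (F + c • G)
  bounded : ∀ {F}, P F → ∀ h₀ ∈ Set.Ioo (0 : ℝ) 1, ∃ C, ∀ᶠ h in nhds h₀, ∀ x, ∀ y ∈ S,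
    ‖F (x, y, h)‖ ≤ C

lemma IsKernelClass.kernelLaplace {S : Set E} {P : (E × E × ℝ → ℂ) → Prop}
    (hP : IsKernelClass S P) {ι : Type*} [Fintype ι] (w : ι → E × E × ℝ) {F : E × E × ℝ → ℂ}
    (hF : P F) : P (kernelLaplace w F) :=
  add_smul_sum_induction (P := P) (fun _ _ h h' c => hP.add_smul h h' c) _ hF
    (fun i => hP.kernelDeriv (hP.kernelDeriv hF (w i)) (w i)) _

lemma IsKernelClass.iterate_kernelLaplace {S : Set E} {P : (E × E × ℝ → ℂ) → Prop}
    (hP : IsKernelClass S P) {ι : Type*} [Fintype ι] (w : ι → E × E × ℝ) (k : ℕ)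
    {F : E × E × ℝ → ℂ} (hF : P F) : P ((_root_.kernelLaplace w)^[k] F) := by
  induction k with
  | zero => exact hF
  | succ k ih =>
    rw [Function.iterate_succ_apply']
    exact hP.kernelLaplace w ih

lemma IsKernelClass.iterate_kernelDeriv {S : Set E} {P : (E × E × ℝ → ℂ) → Prop}
    (hP : IsKernelClass S P) (w : E × E × ℝ) (k : ℕ) {F : E × E × ℝ → ℂ} (hF : P F) :
    P ((_root_.kernelDeriv w)^[k] F) := by
  induction k with
  | zero => exact hF
  | succ k ih => rw [Function.iterate_succ_apply']; exact hP.kernelDeriv ih w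

lemma isKernelClass_isProperKernel [FiniteDimensional ℝ E] {S : Set E} (hS : IsCompact S) :
    IsKernelClass S (IsProperKernel (E := E)) := by
  refine ⟨id, fun h w => h.kernelDeriv w, fun h h' c => h.add_smul h' c, ?_⟩
  intro F hF h₀ hh₀
  obtain ⟨M, hM⟩ := hF.eq_zero
  obtain ⟨R, hR⟩ := hS.isBounded.exists_norm_le
  have hK : IsCompact (Metric.closedBall (0 : E) (R + M) ×ˢ S ×ˢ
      Set.Icc (h₀ / 2) ((h₀ + 1) / 2)) :=
    (isCompact_closedBall _ _).prod (hS.prod isCompact_Icc)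
  have hsub : Metric.closedBall (0 : E) (R + M) ×ˢ S ×ˢ Set.Icc (h₀ / 2) ((h₀ + 1) / 2) ⊆
      kernelDomain E := by
    rintro p ⟨-, -, hp⟩
    exact mem_kernelDomain.2 ⟨by linarith [hp.1, hh₀.1], by linarith [hp.2, hh₀.2]⟩
  obtain ⟨C, hC⟩ := hK.exists_bound_of_continuousOn (hF.contDiffOn.continuousOn.mono hsub)
  refine ⟨max C 0, ?_⟩
  filter_upwards [Icc_mem_nhds (a := h₀ / 2) (b := (h₀ + 1) / 2) (by linarith [hh₀.1])
    (by linarith [hh₀.2])] with h hh x y hy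
  by_cases hxy : M < ‖x - y‖
  · simp [hM (x, y, h) hxy]
  · refine (hC _ ⟨?_, hy, hh⟩).trans (le_max_left _ _)
    rw [mem_closedBall_zero_iff]
    have := norm_sub_norm_le x y
    linarith [hR y hy]

variable [FiniteDimensional ℝ E] [MeasurableSpace E] [BorelSpace E]

lemma integrable_add_norm_pow_mul (v : 𝓢(E, ℂ)) (M : ℝ) (k : ℕ) :
    Integrable (fun y => (‖y‖ + max M 0) ^ k * ‖v y‖) := by
  have h := ((v.integrable_pow_mul volume k).add
    ((v.integrable_pow_mul volume 0).const_mul (max M 0 ^ k))).const_mul (2 ^ (k - 1))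
  refine h.mono' ?_ (Filter.Eventually.of_forall fun y => ?_)
  · exact (((continuous_norm.add continuous_const).pow k).mul
      v.continuous.norm).aestronglyMeasurable
  · rw [Real.norm_of_nonneg (by positivity)]
    refine (mul_le_mul_of_nonneg_right (add_pow_le (norm_nonneg y) (le_max_right M 0) k)
      (norm_nonneg _)).trans (le_of_eq ?_)
    simp
    ring

lemma norm_pow_mul_kernelIntegral_le {F : E × E × ℝ → ℂ} {M : ℝ}
    (hM : ∀ p : E × E × ℝ, M < ‖p.1 - p.2.1‖ → F p = 0) {C h : ℝ} {v : 𝓢(E, ℂ)}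
    (hb : ∀ x y, v y ≠ 0 → ‖F (x, y, h)‖ ≤ C) (k : ℕ) (x : E) :
    ‖x‖ ^ k * ‖kernelIntegral F h v x‖ ≤ ∫ y, C * ((‖y‖ + max M 0) ^ k * ‖v y‖) := by
  calc ‖x‖ ^ k * ‖kernelIntegral F h v x‖
      ≤ ‖x‖ ^ k * ∫ y, ‖F (x, y, h) * v y‖ :=
        mul_le_mul_of_nonneg_left (norm_integral_le_integral_norm _) (by positivity)
    _ = ∫ y, ‖x‖ ^ k * ‖F (x, y, h) * v y‖ := (integral_const_mul _ _).symm
    _ ≤ _ := by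
      refine integral_mono_of_nonneg (Filter.Eventually.of_forall fun y => by positivity)
        ((integrable_add_norm_pow_mul v M k).const_mul C)
        (Filter.Eventually.of_forall fun y => ?_)
      by_cases hv : v y = 0
      · simp [hv]
      have hC := hb x y hv
      have hC0 : 0 ≤ C := (norm_nonneg _).trans hC
      beta_reduce
      by_cases hF : F (x, y, h) = 0
      · rw [hF]
        simp only [zero_mul, norm_zero, mul_zero]
        positivity
      have hxy : ‖x - y‖ ≤ M := not_lt.1 fun hlt => hF (hM (x, y, h) hlt)
      have hx : ‖x‖ ≤ ‖y‖ + max M 0 := by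
        have := norm_sub_norm_le x y
        linarith [le_max_left M 0]
      rw [norm_mul]
      calc ‖x‖ ^ k * (‖F (x, y, h)‖ * ‖v y‖)
          ≤ (‖y‖ + max M 0) ^ k * (C * ‖v y‖) := by gcongr
        _ = _ := by ring

lemma IsKernelClass.exists_schwartz {S : Set E} {P : (E × E × ℝ → ℂ) → Prop}
    (hP : IsKernelClass S P) {F : E × E × ℝ → ℂ} (hF : P F) {v : 𝓢(E, ℂ)}
    (hv : Function.support v ⊆ S) {h : ℝ} (hh : h ∈ Set.Ioo (0 : ℝ) 1) :
    ∃ g : 𝓢(E, ℂ), ∀ x, g x = kernelIntegral F h v x := by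
  refine ⟨⟨kernelIntegral F h v,
    (hP.isProperKernel hF).contDiff_kernelIntegral v.continuous hh, fun k m => ?_⟩, fun x => rfl⟩
  suffices H : ∃ C, ∀ (_ : Unit) x, ‖x‖ ^ k * ‖iteratedFDeriv ℝ m (kernelIntegral F h v) x‖ ≤ C from
    H.imp fun C hC x => hC () x
  refine exists_norm_iteratedFDeriv_bound (stdOrthonormalBasis ℝ E).toBasis
    (P := fun f => ∃ G, P G ∧ f = fun _ => kernelIntegral G h v) (ρ := fun _ x => ‖x‖ ^ k)
    (fun _ x => by positivity) ?_ ?_ ?_ m (fun _ => kernelIntegral F h v) ⟨F, hF, rfl⟩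
  · rintro _ ⟨G, hG, rfl⟩ -
    exact (hP.isProperKernel hG).contDiff_kernelIntegral v.continuous hh
  · rintro _ ⟨G, hG, rfl⟩ j
    refine ⟨_, hP.kernelDeriv hG ((stdOrthonormalBasis ℝ E).toBasis j, 0, 0), ?_⟩
    ext - x
    exact (hP.isProperKernel hG).fderiv_kernelIntegral_left v.continuous hh x _
  · rintro _ ⟨G, hG, rfl⟩
    obtain ⟨M, hM⟩ := (hP.isProperKernel hG).eq_zero
    obtain ⟨C, hC⟩ := hP.bounded hG h hh
    exact ⟨_, fun _ x => norm_pow_mul_kernelIntegral_le hM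
      (fun x y hy => hC.self_of_nhds x y (hv hy)) k x⟩

/-- The operator `1 - Δ / (2π)²` in the first variable of a kernel. -/
def kernelLaplaceLeft (F : E × E × ℝ → ℂ) : E × E × ℝ → ℂ :=
  kernelLaplace (fun i => (stdOrthonormalBasis ℝ E i, 0, 0)) F

/-- The operator `1 - Δ / (2π)²` in the second variable of a kernel. -/
def kernelLaplaceRight (F : E × E × ℝ → ℂ) : E × E × ℝ → ℂ :=
  kernelLaplace (fun i => (0, stdOrthonormalBasis ℝ E i, 0)) F

lemma bessel_two_mul_apply_eq_of_intertwining {w : E → E × E × ℝ}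
    {A : (E × E × ℝ → ℂ) → E → ℂ}
    (hA : ∀ {F G}, IsProperKernel F → IsProperKernel G → ∀ (c : ℝ) x,
      A (F + c • G) x = A F x + c • A G x)
    (hA' : ∀ {F}, IsProperKernel F → ∀ x e, fderiv ℝ (A F) x e = A (kernelDeriv (w e) F) x)
    (N : ℕ) : ∀ {F : E × E × ℝ → ℂ}, IsProperKernel F → ∀ {g : 𝓢(E, ℂ)}, (∀ x, g x = A F x) →
    ∀ x, bessel (2 * N) g x =
      A ((kernelLaplace fun i => w (stdOrthonormalBasis ℝ E i))^[N] F) x := by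
  have hd : ∀ {F : E × E × ℝ → ℂ}, IsProperKernel F → ∀ {g : 𝓢(E, ℂ)}, (∀ x, g x = A F x) →
      ∀ e x, (∂_{e} g) x = A (kernelDeriv (w e) F) x := by
    intro F hF g hg e x
    rw [SchwartzMap.lineDerivOp_apply_eq_fderiv, funext hg, hA' hF]
  have hsum : ∀ {ι : Type} (s : Finset ι) {F : E × E × ℝ → ℂ} (_ : IsProperKernel F)
      {G : ι → E × E × ℝ → ℂ} (_ : ∀ i, IsProperKernel (G i)) (c : ℝ) (x : E),
      A (F + c • ∑ i ∈ s, G i) x = A F x + c • ∑ i ∈ s, A (G i) x := by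
    intro ι s F hF G hG c x
    classical
    induction s using Finset.induction with
    | empty => simp
    | insert i s hi ih =>
      rw [Finset.sum_insert hi, Finset.sum_insert hi, smul_add, smul_add, add_comm (c • G i),
        add_comm (c • A (G i) x), ← add_assoc, ← add_assoc, hA
        (add_smul_sum_induction (fun _ _ h h' c => h.add_smul h' c) s hF hG c) (hG i), ih]
  induction N with
  | zero =>
    intro F hF g hg x
    simpa [bessel_zero] using hg x
  | succ N ih =>
    intro F hF g hg x
    rw [bessel_two_mul_succ', Function.iterate_succ_apply]
    refine ih (hF.kernelLaplace _) (fun x => ?_) x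
    rw [bessel_two, SchwartzMap.laplacian_eq_sum (stdOrthonormalBasis ℝ E), kernelLaplace,
      hsum _ hF fun i => (hF.kernelDeriv _).kernelDeriv _]
    simp only [sub_apply, smul_apply, sum_apply, hg x, neg_smul]
    rw [sub_eq_add_neg]
    congr 3
    exact Finset.sum_congr rfl fun i _ => hd (hF.kernelDeriv _) (hd hF hg _) _ x

lemma IsProperKernel.bessel_kernelIntegral {F : E × E × ℝ → ℂ} (hF : IsProperKernel F)
    {v : E → ℂ} (hv : Continuous v) {h : ℝ} (hh : h ∈ Set.Ioo (0 : ℝ) 1) {g : 𝓢(E, ℂ)}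
    (hg : ∀ x, g x = kernelIntegral F h v x) (N : ℕ) (x : E) :
    bessel (2 * N) g x = kernelIntegral (kernelLaplaceLeft^[N] F) h v x :=
  bessel_two_mul_apply_eq_of_intertwining (w := fun e => (e, 0, 0))
    (A := fun F => kernelIntegral F h v)
    (fun hF hG c x => kernelIntegral_add_smul hF hG c hh hv x)
    (fun hF x e => hF.fderiv_kernelIntegral_left hv hh x e) N hF hg x

lemma IsProperKernel.bessel_slice {F : E × E × ℝ → ℂ} (hF : IsProperKernel F) {h : ℝ}
    (hh : h ∈ Set.Ioo (0 : ℝ) 1) (N : ℕ) (x y : E) :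
    bessel (2 * N) (hF.slice hh x) y = kernelLaplaceRight^[N] F (x, y, h) :=
  bessel_two_mul_apply_eq_of_intertwining (w := fun e => (0, e, 0))
    (A := fun F y => F (x, y, h)) (fun _ _ _ _ => rfl)
    (fun hF y e => hF.fderiv_slice_right hh x y e) N hF (fun _ => rfl) y

lemma IsProperKernel.kernelIntegral_bessel {F : E × E × ℝ → ℂ} (hF : IsProperKernel F) {h : ℝ}
    (hh : h ∈ Set.Ioo (0 : ℝ) 1) (N : ℕ) (u : 𝓢(E, ℂ)) (x : E) :
    kernelIntegral F h (bessel (2 * N) u) x = kernelIntegral (kernelLaplaceRight^[N] F) h u x := by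
  refine (integral_mul_bessel N (hF.slice hh x) u).trans ?_
  simp only [hF.bessel_slice hh, kernelIntegral]

end KernelClass

section Commutation

variable {E : Type*} [NormedAddCommGroup E] [InnerProductSpace ℝ E] [FiniteDimensional ℝ E]
  [MeasurableSpace E] [BorelSpace E]

lemma norm_kernelIntegral_le_rpow {F : E × E × ℝ → ℂ} {M : ℝ}
    (hM : ∀ p : E × E × ℝ, M < ‖p.1 - p.2.1‖ → F p = 0) (C : ℝ) (v : 𝓢(E, ℂ)) (r : ℕ) :
    ∃ B : ℝ, 0 ≤ B ∧ ∀ h : ℝ, (∀ x y, v y ≠ 0 → ‖F (x, y, h)‖ ≤ C) → ∀ x,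
      ‖kernelIntegral F h v x‖ ≤ B * (1 + ‖x‖) ^ (-(r : ℝ)) := by
  let J : ℕ → ℝ := fun k => ∫ y, C * ((‖y‖ + max M 0) ^ k * ‖v y‖)
  refine ⟨|2 ^ (r - 1) * (J 0 + J r)|, abs_nonneg _, fun h hb x => ?_⟩
  have h0 := norm_pow_mul_kernelIntegral_le hM hb 0 x
  have hr := norm_pow_mul_kernelIntegral_le hM hb r x
  rw [Real.rpow_neg (by positivity), Real.rpow_natCast, ← div_eq_mul_inv,
    le_div_iff₀ (by positivity), mul_comm]
  calc (1 + ‖x‖) ^ r * ‖kernelIntegral F h v x‖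
      ≤ (2 ^ (r - 1) * (1 ^ r + ‖x‖ ^ r)) * ‖kernelIntegral F h v x‖ :=
        mul_le_mul_of_nonneg_right (add_pow_le zero_le_one (norm_nonneg x) r) (norm_nonneg _)
    _ = 2 ^ (r - 1) * (‖x‖ ^ 0 * ‖kernelIntegral F h v x‖ +
        ‖x‖ ^ r * ‖kernelIntegral F h v x‖) := by simp; ring
    _ ≤ 2 ^ (r - 1) * (J 0 + J r) := by gcongr
    _ ≤ _ := le_abs_self _

lemma IsKernelClass.hasDerivAt_bessel {S : Set E} {P : (E × E × ℝ → ℂ) → Prop}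
    (hP : IsKernelClass S P) {F : E × E × ℝ → ℂ} (hF : P F) {v : 𝓢(E, ℂ)}
    (hv : Function.support v ⊆ S) {h₀ : ℝ} (hh₀ : h₀ ∈ Set.Ioo (0 : ℝ) 1) {g : ℝ → 𝓢(E, ℂ)}
    (hg : ∀ h ∈ Set.Ioo (0 : ℝ) 1, ∀ x, g h x = kernelIntegral F h v x) {g' : 𝓢(E, ℂ)}
    (hg' : ∀ x, g' x = kernelIntegral (_root_.kernelDeriv (0, 0, 1) F) h₀ v x) (s : ℝ) (x : E) :
    HasDerivAt (fun h => bessel s (g h) x) (h₀⁻¹ * bessel s g' x) h₀ := by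
  obtain ⟨N, hN⟩ := exists_bessel_apply_eq_integral (E := E) s
  obtain ⟨Φ, hΦ, ⟨B, hB⟩, hΦs⟩ := hN x
  have hF' : IsProperKernel F := hP.isProperKernel hF
  set F₁ := kernelLaplaceLeft^[N] F with hF₁
  have hPF₁ : P F₁ := hP.iterate_kernelLaplace _ N hF
  have hpF₁ : IsProperKernel F₁ := hP.isProperKernel hPF₁
  set F₂ := _root_.kernelDeriv (0, 0, 1) F₁ with hF₂
  have hPF₂ : P F₂ := hP.kernelDeriv hPF₁ _
  have hpF₂ : IsProperKernel F₂ := hP.isProperKernel hPF₂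
  have hcont : ∀ {G : E × E × ℝ → ℂ}, IsProperKernel G → ∀ h ∈ Set.Ioo (0 : ℝ) 1,
      Continuous (kernelIntegral G h v) := fun hG h hh =>
    (hG.contDiff_kernelIntegral v.continuous hh).continuous
  have hval : h₀⁻¹ * bessel s g' x = ∫ y, Φ y * (h₀⁻¹ * kernelIntegral F₂ h₀ v y) := by
    rw [hΦs, ← integral_const_mul]
    refine integral_congr_ae (Filter.Eventually.of_forall fun y => ?_)
    beta_reduce
    have hcomm : kernelIntegral (kernelLaplaceLeft^[N] (_root_.kernelDeriv (0, 0, 1) F)) h₀ v y =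
        kernelIntegral F₂ h₀ v y :=
      kernelIntegral_congr (iterate_kernelLaplace_kernelDeriv hF'
        (fun i => (stdOrthonormalBasis ℝ E i, 0, 0)) (0, 0, 1) N) hh₀ v y
    rw [(hF'.kernelDeriv _).bessel_kernelIntegral v.continuous hh₀ hg', hcomm]
    exact mul_left_comm _ _ _
  have hev : (fun h => ∫ y, Φ y * kernelIntegral F₁ h v y) =ᶠ[nhds h₀]
      fun h => bessel s (g h) x := by
    filter_upwards [Ioo_mem_nhds hh₀.1 hh₀.2] with h hh
    rw [hΦs]
    simp only [hF'.bessel_kernelIntegral v.continuous hh (hg h hh), hF₁]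
  rw [hval]
  refine HasDerivAt.congr_of_eventuallyEq ?_ hev.symm
  obtain ⟨C, hC⟩ := hP.bounded hPF₂ h₀ hh₀
  obtain ⟨C₁, hC₁⟩ := hP.bounded hPF₁ h₀ hh₀
  obtain ⟨M, hM⟩ := hpF₂.eq_zero
  obtain ⟨M₁, hM₁⟩ := hpF₁.eq_zero
  obtain ⟨K, hK0, hK⟩ := norm_kernelIntegral_le_rpow hM C v (Module.finrank ℝ E + 1)
  obtain ⟨K₁, hK₁0, hK₁⟩ := norm_kernelIntegral_le_rpow hM₁ C₁ v (Module.finrank ℝ E + 1)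
  have hint : Integrable fun y : E => (1 + ‖y‖) ^ (-((Module.finrank ℝ E + 1 : ℕ) : ℝ)) :=
    integrable_one_add_norm (by push_cast; linarith)
  have hB0 : 0 ≤ B := (norm_nonneg _).trans (hB x)
  refine (hasDerivAt_integral_of_dominated_loc_of_deriv_le (μ := volume)
    (F := fun h y => Φ y * kernelIntegral F₁ h v y)
    (F' := fun h y => Φ y * (h⁻¹ * kernelIntegral F₂ h v y))
    (bound := fun y => B * ((h₀ / 2)⁻¹ * (K * (1 + ‖y‖) ^ (-((Module.finrank ℝ E + 1 : ℕ) : ℝ)))))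
    (Filter.inter_mem hC (Ioo_mem_nhds (show h₀ / 2 < h₀ by linarith [hh₀.1]) hh₀.2))
    ?_ ?_ ?_ ?_ ?_ ?_).2
  · filter_upwards [Ioo_mem_nhds hh₀.1 hh₀.2] with h hh
    exact (hΦ.mul (hcont hpF₁ h hh)).aestronglyMeasurable
  · refine ((hint.const_mul K₁).const_mul B).mono'
      (hΦ.mul (hcont hpF₁ h₀ hh₀)).aestronglyMeasurable (Filter.Eventually.of_forall fun y => ?_)
    rw [norm_mul]
    exact mul_le_mul (hB y) (hK₁ h₀ (fun x y hy => hC₁.self_of_nhds x y (hv hy)) y)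
      (norm_nonneg _) hB0
  · exact (hΦ.mul (continuous_const.mul (hcont hpF₂ h₀ hh₀))).aestronglyMeasurable
  · refine Filter.Eventually.of_forall fun y h hh => ?_
    have hpos : 0 < h₀ / 2 := by linarith [hh₀.1]
    rw [norm_mul, norm_mul]
    refine mul_le_mul (hB y) (mul_le_mul ?_ (hK h (fun x y hy => hh.1 x y (hv hy)) y)
      (norm_nonneg _) (by positivity)) (by positivity) hB0
    rw [Complex.norm_real, Real.norm_of_nonneg (inv_nonneg.2 (hpos.le.trans hh.2.1.le))]
    exact inv_anti₀ hpos hh.2.1.le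
  · exact ((hint.const_mul K).const_mul _).const_mul B
  · refine Filter.Eventually.of_forall fun y h hh => ?_
    have hh' : h ∈ Set.Ioo (0 : ℝ) 1 := ⟨by linarith [hh.2.1, hh₀.1], hh.2.2⟩
    simpa using (hpF₁.hasDerivAt_kernelIntegral v.continuous hh' y).const_mul (Φ y)

end Commutation

section Bracket

variable {n}

lemma japaneseBracket_schwartz (β : ℕ) (f : 𝓢(EuclideanSpace ℝ (Fin n), ℂ)) :
    japaneseBracket n β f = bessel β f := by
  ext x
  simp only [japaneseBracket, bessel, SchwartzMap.fourierMultiplierCLM_apply]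
  rw [SchwartzMap.fourierInv_coe]
  refine congrFun (congrArg 𝓕⁻ (funext fun ξ => ?_)) x
  rw [SchwartzMap.smulLeftCLM_apply_apply (by fun_prop), smul_eq_mul, SchwartzMap.fourier_coe]

/-- An `h`-dependent kernel as a function on the product space. -/
def uncurryKernel
    (κ : EuclideanSpace ℝ (Fin n) → EuclideanSpace ℝ (Fin n) → ℝ → ℂ) :
    EuclideanSpace ℝ (Fin n) × EuclideanSpace ℝ (Fin n) × ℝ → ℂ :=
  fun p => κ p.1 p.2.1 p.2.2

lemma iterate_hDhK_eq {κ : EuclideanSpace ℝ (Fin n) → EuclideanSpace ℝ (Fin n) → ℝ → ℂ}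
    (hκ : IsProperKernel (uncurryKernel κ)) (α : ℕ) {h : ℝ} (hh : h ∈ Set.Ioo (0 : ℝ) 1)
    (x y : EuclideanSpace ℝ (Fin n)) :
    (hDhK n)^[α] κ x y h = (kernelDeriv (0, 0, 1))^[α] (uncurryKernel κ) (x, y, h) := by
  induction α generalizing h with
  | zero => rfl
  | succ α ih =>
    rw [Function.iterate_succ_apply', Function.iterate_succ_apply',
      ← (hκ.iterate_kernelDeriv _ α).deriv_param hh]
    simp only [hDhK]
    congr 1
    refine Filter.EventuallyEq.deriv_eq ?_
    filter_upwards [Ioo_mem_nhds hh.1 hh.2] with h' hh' using ih hh'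

lemma IsKernelClass.iterate_hDh_eq {S : Set (EuclideanSpace ℝ (Fin n))}
    {P : (EuclideanSpace ℝ (Fin n) × EuclideanSpace ℝ (Fin n) × ℝ → ℂ) → Prop}
    (hP : IsKernelClass S P)
    {κ : EuclideanSpace ℝ (Fin n) → EuclideanSpace ℝ (Fin n) → ℝ → ℂ}
    (hκ : P (uncurryKernel κ)) {v : 𝓢(EuclideanSpace ℝ (Fin n), ℂ)}
    (hv : Function.support v ⊆ S) (β α : ℕ) {h : ℝ} (hh : h ∈ Set.Ioo (0 : ℝ) 1)
    {g : 𝓢(EuclideanSpace ℝ (Fin n), ℂ)}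
    (hg : ∀ x, g x =
      kernelIntegral ((_root_.kernelDeriv (0, 0, 1))^[α] (uncurryKernel κ)) h v x)
    (x : EuclideanSpace ℝ (Fin n)) :
    (hDh n)^[α] (fun h' => japaneseBracket n β (kernelOp n κ h' v)) h x = bessel β g x := by
  induction α generalizing h g x with
  | zero => rw [← japaneseBracket_schwartz, funext hg]; rfl
  | succ α ih =>
    have hPα : P ((_root_.kernelDeriv (0, 0, 1))^[α] (uncurryKernel κ)) :=
      hP.iterate_kernelDeriv _ α hκ
    have hex : ∀ h' : ℝ, ∃ G : 𝓢(EuclideanSpace ℝ (Fin n), ℂ), h' ∈ Set.Ioo (0 : ℝ) 1 →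
        ∀ x, G x =
          kernelIntegral ((_root_.kernelDeriv (0, 0, 1))^[α] (uncurryKernel κ)) h' v x := by
      intro h'
      by_cases hh' : h' ∈ Set.Ioo (0 : ℝ) 1
      · obtain ⟨G, hG⟩ := hP.exists_schwartz hPα hv hh'
        exact ⟨G, fun _ => hG⟩
      · exact ⟨0, fun H => absurd H hh'⟩
    choose G hG using hex
    rw [Function.iterate_succ_apply'] at hg ⊢
    have hd := hP.hasDerivAt_bessel hPα hv hh (g := G) (fun h' hh' => hG h' hh') hg β x
    have hev : (fun h' => (hDh n)^[α]
        (fun h' => japaneseBracket n β (kernelOp n κ h' v)) h' x) =ᶠ[nhds h]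
        fun h' => bessel β (G h') x := by
      filter_upwards [Ioo_mem_nhds hh.1 hh.2] with h' hh' using ih hh' (hG h' hh') x
    have h0 : (h : ℂ) ≠ 0 := by exact_mod_cast hh.1.ne'
    rw [hDh, hev.deriv_eq, hd.deriv, Complex.ofReal_inv, mul_inv_cancel_left₀ h0]

end Bracket

section Schur

variable {E : Type*} [NormedAddCommGroup E] [InnerProductSpace ℝ E] [FiniteDimensional ℝ E]
  [MeasurableSpace E] [BorelSpace E]

lemma eLpNorm_two_le_of_lintegral_sq_le {X : Type*} [MeasurableSpace X] {μ : Measure X}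
    {f g : X → ℂ} {A : ℝ≥0∞}
    (h : ∫⁻ x, ‖f x‖ₑ ^ (2 : ℝ) ∂μ ≤ A ^ (2 : ℝ) * ∫⁻ x, ‖g x‖ₑ ^ (2 : ℝ) ∂μ) :
    eLpNorm f 2 μ ≤ A * eLpNorm g 2 μ := by
  rw [eLpNorm_eq_lintegral_rpow_enorm_toReal (by simp) (by simp),
    eLpNorm_eq_lintegral_rpow_enorm_toReal (by simp) (by simp)]
  simp only [ENNReal.toReal_ofNat]
  refine (ENNReal.rpow_le_rpow h (by norm_num)).trans_eq ?_
  rw [ENNReal.mul_rpow_of_nonneg _ _ (by norm_num), ← ENNReal.rpow_mul]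
  norm_num

/-- Schur's test for kernels which are bounded and supported near the diagonal. -/
lemma eLpNorm_integral_mul_le {K : E → E → ℂ} {C M : ℝ} (hK : ∀ x y, ‖K x y‖ ≤ C)
    (hM : ∀ x y, M < ‖x - y‖ → K x y = 0) {u : E → ℂ} (hu : Continuous u) :
    eLpNorm (fun x => ∫ y, K x y * u y) 2 volume ≤
      ENNReal.ofReal C * volume (Metric.closedBall (0 : E) M) * eLpNorm u 2 volume := by
  set B := Metric.closedBall (0 : E) M
  have hB : MeasurableSet B := measurableSet_closedBall
  have hmeas : Measurable fun p : E × E => ‖u (p.1 - p.2)‖ₑ ^ (2 : ℝ) :=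
    ((hu.comp (continuous_fst.sub continuous_snd)).enorm.measurable).pow_const _
  have hux : ∀ x, Measurable fun z => ‖u (x - z)‖ₑ := fun x =>
    (hu.comp (continuous_const.sub continuous_id)).enorm.measurable
  have hpt : ∀ x, ‖∫ y, K x y * u y‖ₑ ^ (2 : ℝ) ≤
      ENNReal.ofReal C ^ (2 : ℝ) * (volume B * ∫⁻ z in B, ‖u (x - z)‖ₑ ^ (2 : ℝ)) := by
    intro x
    have hC : ‖∫ y, K x y * u y‖ₑ ≤ ENNReal.ofReal C * ∫⁻ z in B, ‖u (x - z)‖ₑ := by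
      refine (enorm_integral_le_lintegral_enorm _).trans ?_
      rw [← lintegral_sub_left_eq_self _ x, ← lintegral_const_mul _ (hux x),
        ← lintegral_indicator hB]
      refine lintegral_mono fun z => ?_
      by_cases hz : z ∈ B
      · rw [Set.indicator_of_mem hz, enorm_mul]
        gcongr
        rw [← ofReal_norm]
        exact ENNReal.ofReal_le_ofReal (hK _ _)
      · have : K x (x - z) = 0 := hM _ _ (by simpa [B] using hz)
        simp [this]
    have hCS : (∫⁻ z in B, ‖u (x - z)‖ₑ) ^ (2 : ℝ) ≤
        volume B * ∫⁻ z in B, ‖u (x - z)‖ₑ ^ (2 : ℝ) := by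
      have := ENNReal.lintegral_mul_le_Lp_mul_Lq (volume.restrict B) Real.HolderConjugate.two_two
        (f := fun _ => 1) (g := fun z => ‖u (x - z)‖ₑ) aemeasurable_const (hux x).aemeasurable
      simp only [Pi.mul_apply, one_mul, ENNReal.one_rpow, lintegral_const,
        Measure.restrict_apply_univ] at this
      refine (ENNReal.rpow_le_rpow this (by norm_num)).trans_eq ?_
      rw [ENNReal.mul_rpow_of_nonneg _ _ (by norm_num), ← ENNReal.rpow_mul, ← ENNReal.rpow_mul]
      norm_num
    refine (ENNReal.rpow_le_rpow hC (by norm_num)).trans ?_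
    rw [ENNReal.mul_rpow_of_nonneg _ _ (by norm_num)]
    gcongr
  refine eLpNorm_two_le_of_lintegral_sq_le ((lintegral_mono hpt).trans_eq ?_)
  rw [lintegral_const_mul _ (by fun_prop), lintegral_const_mul _ (by fun_prop),
    lintegral_lintegral_swap hmeas.aemeasurable]
  simp only [lintegral_sub_right_eq_self (fun x => ‖u x‖ₑ ^ (2 : ℝ)), lintegral_const,
    Measure.restrict_apply_univ]
  rw [ENNReal.mul_rpow_of_nonneg _ _ (by norm_num), ENNReal.rpow_two (volume B), sq]
  simp only [mul_left_comm, mul_comm]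

lemma eLpNorm_bessel_le {s t : ℝ} (hst : s ≤ t) (f : 𝓢(E, ℂ)) :
    eLpNorm (bessel s f) 2 volume ≤ eLpNorm (bessel t f) 2 volume := by
  have := norm_toLp_bessel_le hst f
  rwa [SchwartzMap.norm_toLp, SchwartzMap.norm_toLp, ENNReal.toReal_le_toReal
    (SchwartzMap.memLp _ _ _).eLpNorm_ne_top (SchwartzMap.memLp _ _ _).eLpNorm_ne_top] at this

lemma eLpNorm_smul_bessel_le {s t : ℝ} (hst : s ≤ t) (c : ℝ) (f : 𝓢(E, ℂ)) :
    eLpNorm (fun x => c • bessel s f x) 2 volume ≤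
      eLpNorm (fun x => c • bessel t f x) 2 volume := by
  have h : ∀ r, eLpNorm (fun x => c • bessel r f x) 2 volume =
      ‖c‖ₑ * eLpNorm (bessel r f) 2 volume := fun r =>
    eLpNorm_const_smul c (bessel r f : E → ℂ) 2 volume
  rw [h, h]
  gcongr
  exact eLpNorm_bessel_le hst f

end Schur

section KernelBounds

variable {E : Type*} [NormedAddCommGroup E] [InnerProductSpace ℝ E]

/-- The bounds `sup |h ^ l (h ∂_h) ^ α ∂ ^ m F| < ∞` on a kernel. -/
def HasKernelBounds (l : ℝ) (F : E × E × ℝ → ℂ) : Prop :=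
  ∀ α m : ℕ, ∃ C : ℝ, ∀ h ∈ Set.Ioo (0 : ℝ) 1, ∀ q : E × E,
    h ^ l * ‖iteratedFDeriv ℝ m
      (fun q : E × E => (kernelDeriv (0, 0, 1))^[α] F (q.1, q.2, h)) q‖ ≤ C

lemma HasKernelBounds.add_smul {l : ℝ} {F G : E × E × ℝ → ℂ} (hF : IsProperKernel F)
    (hG : IsProperKernel G) (hFb : HasKernelBounds l F) (hGb : HasKernelBounds l G) (c : ℝ) :
    HasKernelBounds l (F + c • G) := by
  intro α m
  obtain ⟨C, hC⟩ := hFb α m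
  obtain ⟨D, hD⟩ := hGb α m
  refine ⟨C + |c| * D, fun h hh q => ?_⟩
  have heq : (fun q : E × E => (kernelDeriv (0, 0, 1))^[α] (F + c • G) (q.1, q.2, h)) =
      (fun q : E × E => (kernelDeriv (0, 0, 1))^[α] F (q.1, q.2, h)) +
        c • fun q : E × E => (kernelDeriv (0, 0, 1))^[α] G (q.1, q.2, h) :=
    funext fun q => iterate_kernelDeriv_add_smul hF hG c _ α (mk_mem_kernelDomain hh q.1 q.2)
  have hs : ∀ {F : E × E × ℝ → ℂ}, IsProperKernel F → ContDiffAt ℝ m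
      (fun q : E × E => (kernelDeriv (0, 0, 1))^[α] F (q.1, q.2, h)) q := fun hF =>
    ((hF.iterate_kernelDeriv _ α).contDiff_slice hh).contDiffAt.of_le
      (WithTop.coe_le_coe.2 le_top)
  have hsG : ContDiffAt ℝ m
      (c • fun q : E × E => (kernelDeriv (0, 0, 1))^[α] G (q.1, q.2, h)) q := (hs hG).const_smul c
  rw [heq, iteratedFDeriv_add_apply (hs hF) hsG,
    iteratedFDeriv_const_smul_apply (hs hG)]
  have hl : 0 ≤ h ^ l := Real.rpow_nonneg hh.1.le l
  calc _ ≤ h ^ l * (‖iteratedFDeriv ℝ m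
          (fun q : E × E => (kernelDeriv (0, 0, 1))^[α] F (q.1, q.2, h)) q‖ +
        |c| * ‖iteratedFDeriv ℝ m
          (fun q : E × E => (kernelDeriv (0, 0, 1))^[α] G (q.1, q.2, h)) q‖) := by
        gcongr
        refine (norm_add_le _ _).trans_eq ?_
        rw [norm_smul, Real.norm_eq_abs]
    _ = _ := by ring
    _ ≤ _ := add_le_add (hC h hh q) (mul_le_mul_of_nonneg_left (hD h hh q) (abs_nonneg c))

lemma HasKernelBounds.kernelDeriv {l : ℝ} {F : E × E × ℝ → ℂ} (hF : IsProperKernel F)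
    (hFb : HasKernelBounds l F) (w : E × E × ℝ) : HasKernelBounds l (kernelDeriv w F) := by
  obtain ⟨a, b, c⟩ := w
  rw [kernelDeriv_eq_add_smul]
  refine HasKernelBounds.add_smul (hF.kernelDeriv _) (hF.kernelDeriv _) ?_
    (fun α m => hFb (α + 1) m) c
  intro α m
  obtain ⟨C, hC⟩ := hFb α (m + 1)
  refine ⟨‖(a, b)‖ * C, fun h hh q => ?_⟩
  set f := fun q : E × E => (_root_.kernelDeriv (0, 0, 1))^[α] F (q.1, q.2, h)
  have heq : (fun q : E × E => (_root_.kernelDeriv (0, 0, 1))^[α]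
      (_root_.kernelDeriv (a, b, 0) F) (q.1, q.2, h)) = fun q => fderiv ℝ f q (a, b) := by
    ext q
    rw [iterate_kernelDeriv_comm hF _ _ α (mk_mem_kernelDomain hh q.1 q.2),
      ← (hF.iterate_kernelDeriv _ α).fderiv_slice hh q (a, b)]
  have hf : ContDiff ℝ ∞ (fderiv ℝ f) :=
    ((hF.iterate_kernelDeriv _ α).contDiff_slice hh).fderiv_right (by simp)
  have h1 : ‖iteratedFDeriv ℝ m (fun q => fderiv ℝ f q (a, b)) q‖ ≤
      ‖(a, b)‖ * ‖iteratedFDeriv ℝ (m + 1) f q‖ := by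
    rw [← norm_iteratedFDeriv_fderiv]
    refine ((ContinuousLinearMap.apply ℝ ℂ (a, b)).norm_iteratedFDeriv_comp_left
      hf.contDiffAt (WithTop.coe_le_coe.2 le_top)).trans ?_
    gcongr
    exact ContinuousLinearMap.opNorm_le_bound _ (norm_nonneg _) fun A => by
      simpa [mul_comm] using A.le_opNorm (a, b)
  rw [heq]
  calc _ ≤ h ^ l * (‖(a, b)‖ * ‖iteratedFDeriv ℝ (m + 1) f q‖) :=
        mul_le_mul_of_nonneg_left h1 (Real.rpow_nonneg hh.1.le l)
    _ = ‖(a, b)‖ * (h ^ l * ‖iteratedFDeriv ℝ (m + 1) f q‖) := by ring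
    _ ≤ _ := mul_le_mul_of_nonneg_left (hC h hh q) (norm_nonneg _)

lemma HasKernelBounds.exists_norm_le {l : ℝ} {F : E × E × ℝ → ℂ} (hFb : HasKernelBounds l F) :
    ∃ C, ∀ h ∈ Set.Ioo (0 : ℝ) 1, ∀ x y, h ^ l * ‖F (x, y, h)‖ ≤ C := by
  obtain ⟨C, hC⟩ := hFb 0 0
  exact ⟨C, fun h hh x y => by simpa using hC h hh (x, y)⟩

lemma isKernelClass_hasKernelBounds (l : ℝ) :
    IsKernelClass (Set.univ : Set E) fun F => IsProperKernel F ∧ HasKernelBounds l F where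
  isProperKernel hF := hF.1
  kernelDeriv hF w := ⟨hF.1.kernelDeriv w, hF.2.kernelDeriv hF.1 w⟩
  add_smul hF hG c := ⟨hF.1.add_smul hG.1 c, hF.2.add_smul hF.1 hG.1 hG.2 c⟩
  bounded := by
    rintro F ⟨-, hF⟩ h₀ hh₀
    obtain ⟨C, hC⟩ := hF.exists_norm_le
    have hc : ContinuousAt (fun h : ℝ => h ^ l) h₀ :=
      Real.continuousAt_rpow_const _ _ (Or.inl hh₀.1.ne')
    have hpos : 0 < h₀ ^ l := Real.rpow_pos_of_pos hh₀.1 l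
    refine ⟨C / (h₀ ^ l / 2), ?_⟩
    filter_upwards [Ioo_mem_nhds hh₀.1 hh₀.2,
      hc.eventually (lt_mem_nhds (show h₀ ^ l / 2 < h₀ ^ l by linarith))] with h hh hlt x y _
    rw [le_div_iff₀ (by positivity), mul_comm]
    exact (mul_le_mul_of_nonneg_right hlt.le (norm_nonneg _)).trans (hC h hh x y)

end KernelBounds

section Converse

variable {n}

lemma HasKernelBounds.opBounds {l : ℝ}
    {κ : EuclideanSpace ℝ (Fin n) → EuclideanSpace ℝ (Fin n) → ℝ → ℂ}
    (hκ : IsProperKernel (uncurryKernel κ)) (hb : HasKernelBounds l (uncurryKernel κ)) :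
    OpBounds n l κ := by
  intro α β γ
  have hP := isKernelClass_hasKernelBounds (E := EuclideanSpace ℝ (Fin n)) l
  have hF := hP.iterate_kernelDeriv (0, 0, 1) α ⟨hκ, hb⟩
  set F := (_root_.kernelDeriv (0, 0, 1))^[α] (uncurryKernel κ)
  have hG : IsProperKernel (kernelLaplaceLeft^[β] F) ∧
      HasKernelBounds l (kernelLaplaceLeft^[β] F) := hP.iterate_kernelLaplace
    (fun i => (stdOrthonormalBasis ℝ (EuclideanSpace ℝ (Fin n)) i, 0, 0)) β hF
  have hG' : IsProperKernel (kernelLaplaceRight^[γ] (kernelLaplaceLeft^[β] F)) ∧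
      HasKernelBounds l (kernelLaplaceRight^[γ] (kernelLaplaceLeft^[β] F)) :=
    hP.iterate_kernelLaplace
    (fun i => (0, stdOrthonormalBasis ℝ (EuclideanSpace ℝ (Fin n)) i, 0)) γ hG
  obtain ⟨C, hC⟩ := hG'.2.exists_norm_le
  obtain ⟨M, hM⟩ := hG'.1.eq_zero
  refine ⟨C * (volume (Metric.closedBall (0 : EuclideanSpace ℝ (Fin n)) M)).toReal,
    fun u h h0 h1 => ?_⟩
  have hh : h ∈ Set.Ioo (0 : ℝ) 1 := ⟨h0, h1⟩
  have hl : 0 ≤ h ^ l := Real.rpow_nonneg h0.le l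
  obtain ⟨g, hg⟩ := hP.exists_schwartz hF (Set.subset_univ (Function.support (bessel γ u))) hh
  have hu : bessel γ u = bessel (2 * γ) (bessel (-γ) u) := by
    rw [bessel_bessel, show 2 * (γ : ℝ) + -γ = γ by ring]
  simp only [show (fun y => u y) = u from rfl, japaneseBracket_schwartz,
    hP.iterate_hDh_eq ⟨hκ, hb⟩ (Set.subset_univ _) β α hh hg]
  calc eLpNorm (fun x => (h ^ l : ℝ) • bessel β g x) 2 volume
      ≤ eLpNorm (fun x => (h ^ l : ℝ) • bessel (2 * β) g x) 2 volume :=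
        eLpNorm_smul_bessel_le (by linarith [(Nat.cast_nonneg β : (0 : ℝ) ≤ β)]) _ g
    _ = eLpNorm (fun x => ∫ y, ((h ^ l : ℝ) * kernelLaplaceRight^[γ] (kernelLaplaceLeft^[β] F)
          (x, y, h)) * bessel (-γ) u y) 2 volume := by
        congr 1
        ext x
        rw [hF.1.bessel_kernelIntegral (SchwartzMap.continuous _) hh hg, hu,
          hG.1.kernelIntegral_bessel hh, Complex.real_smul, kernelIntegral,
          ← integral_const_mul]
        simp only [mul_assoc]
    _ ≤ ENNReal.ofReal C * volume (Metric.closedBall (0 : EuclideanSpace ℝ (Fin n)) M) *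
          eLpNorm (bessel (-γ) u) 2 volume := by
        refine eLpNorm_integral_mul_le (fun x y => ?_) (fun x y hxy => ?_)
          (SchwartzMap.continuous _)
        · rw [norm_mul, Complex.norm_real, Real.norm_of_nonneg hl]
          exact hC h hh x y
        · exact mul_eq_zero_of_right _ (hM (x, y, h) hxy)
    _ ≤ ENNReal.ofReal C * volume (Metric.closedBall (0 : EuclideanSpace ℝ (Fin n)) M) *
          eLpNorm u 2 volume := by
        gcongr
        simpa only [bessel_zero] using eLpNorm_bessel_le
          (show (-γ : ℝ) ≤ 0 by linarith [(Nat.cast_nonneg γ : (0 : ℝ) ≤ γ)]) u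
    _ = _ := by
        rw [ENNReal.ofReal_mul' ENNReal.toReal_nonneg,
          ENNReal.ofReal_toReal (isCompact_closedBall _ _).measure_ne_top]

end Converse

section OperatorBounds

variable {E : Type*} [NormedAddCommGroup E] [InnerProductSpace ℝ E] [FiniteDimensional ℝ E]
  [MeasurableSpace E] [BorelSpace E]

lemma hasCompactSupport_bessel_two_mul {f : 𝓢(E, ℂ)} (hf : HasCompactSupport f) (N : ℕ) :
    HasCompactSupport (bessel (2 * N) f) := by
  induction N with
  | zero => simpa [bessel_zero] using hf
  | succ N ih =>
    rw [bessel_two_mul_succ, bessel_two, SchwartzMap.laplacian_eq_sum (stdOrthonormalBasis ℝ E)]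
    refine HasCompactSupport.intro ih.isCompact fun x hx => ?_
    have hd : ∀ e, (∂_{e} (∂_{e} (bessel (2 * N) f) : 𝓢(E, ℂ)) : 𝓢(E, ℂ)) x = 0 := fun e =>
      image_eq_zero_of_notMem_tsupport fun h => hx
        (SchwartzMap.tsupport_lineDerivOp_subset _ _
          (SchwartzMap.tsupport_lineDerivOp_subset _ _ h))
    simp [sub_apply, smul_apply, sum_apply, hd, image_eq_zero_of_notMem_tsupport hx]

/-- Uniform bounds for the operators `h ^ l ⟨Δ⟩ ^ N R ⟨Δ⟩ ^ m`, where `R` has the kernel `F`, tested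
on functions `v` with compact support. -/
def HasOpBounds (l : ℝ) (F : E × E × ℝ → ℂ) : Prop :=
  ∀ N m : ℕ, ∃ C : ℝ, 0 ≤ C ∧ ∀ h ∈ Set.Ioo (0 : ℝ) 1, ∀ v g : 𝓢(E, ℂ), HasCompactSupport v →
    (∀ x, g x = kernelIntegral F h v x) →
    h ^ l * ‖(bessel (2 * N) g).toLp 2‖ ≤ C * ‖(bessel (-(2 * m)) v).toLp 2‖

lemma IsProperKernel.exists_schwartz {F : E × E × ℝ → ℂ} (hF : IsProperKernel F) {v : 𝓢(E, ℂ)}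
    (hv : HasCompactSupport v) {h : ℝ} (hh : h ∈ Set.Ioo (0 : ℝ) 1) :
    ∃ g : 𝓢(E, ℂ), ∀ x, g x = kernelIntegral F h v x :=
  (isKernelClass_isProperKernel hv.isCompact).exists_schwartz hF (subset_tsupport v) hh

lemma HasOpBounds.kernelDeriv_left {l : ℝ} {F : E × E × ℝ → ℂ} (hF : IsProperKernel F)
    (hb : HasOpBounds l F) (e : E) : HasOpBounds l (kernelDeriv (e, 0, 0) F) := by
  intro N m
  obtain ⟨C, hC0, hC⟩ := hb (N + 1) m
  refine ⟨2 * Real.pi * ‖e‖ * C, by positivity, fun h hh v g hv hg => ?_⟩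
  obtain ⟨g₀, hg₀⟩ := hF.exists_schwartz hv hh
  have hgg : g = ∂_{e} g₀ := by
    ext x
    rw [SchwartzMap.lineDerivOp_apply_eq_fderiv, funext hg₀, hg,
      hF.fderiv_kernelIntegral_left v.continuous hh]
  have hN : (2 * N + 2 : ℝ) = 2 * (N + 1 : ℕ) := by push_cast; ring
  have h1 := norm_toLp_bessel_lineDeriv_le (2 * N) e g₀
  have h2 := hC h hh v g₀ hv hg₀
  rw [hN, ← hgg] at h1
  generalize ‖(bessel (2 * N) g).toLp 2‖ = a at h1 ⊢
  generalize ‖(bessel (2 * (N + 1 : ℕ)) g₀).toLp 2‖ = b at h1 h2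
  generalize ‖(bessel (-(2 * m)) v).toLp 2‖ = c at h2 ⊢
  have h3 := mul_le_mul_of_nonneg_left h1 (Real.rpow_nonneg hh.1.le l)
  have h4 := mul_le_mul_of_nonneg_left h2 (show 0 ≤ 2 * Real.pi * ‖e‖ by positivity)
  linarith

lemma IsProperKernel.kernelIntegral_kernelDeriv_right {F : E × E × ℝ → ℂ} (hF : IsProperKernel F)
    {h : ℝ} (hh : h ∈ Set.Ioo (0 : ℝ) 1) (v : 𝓢(E, ℂ)) (e x : E) :
    kernelIntegral (_root_.kernelDeriv (0, e, 0) F) h v x =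
      kernelIntegral F h (∂_{-e} v : 𝓢(E, ℂ)) x := by
  refine Eq.trans ?_ (SchwartzMap.integral_mul_lineDerivOp_right_eq_neg_left (μ := volume)
    (hF.slice hh x) v (-e)).symm
  rw [← integral_neg]
  refine integral_congr_ae (Filter.Eventually.of_forall fun y => ?_)
  beta_reduce
  rw [SchwartzMap.lineDerivOp_apply_eq_fderiv, map_neg, neg_mul, neg_neg,
    ← hF.fderiv_slice_right hh x y e]
  rfl

lemma HasOpBounds.kernelDeriv_right {l : ℝ} {F : E × E × ℝ → ℂ} (hF : IsProperKernel F)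
    (hb : HasOpBounds l F) (e : E) : HasOpBounds l (kernelDeriv (0, e, 0) F) := by
  intro N m
  obtain ⟨C, hC0, hC⟩ := hb N (m + 1)
  refine ⟨C * (2 * Real.pi * ‖e‖), by positivity, fun h hh v g hv hg => ?_⟩
  have hm : (-(2 * (m + 1 : ℕ)) + 2 : ℝ) = -(2 * m) := by push_cast; ring
  have hv' : HasCompactSupport (∂_{-e} v : 𝓢(E, ℂ)) :=
    hv.of_isClosed_subset (isClosed_tsupport _) (SchwartzMap.tsupport_lineDerivOp_subset _ _)
  have h1 := norm_toLp_bessel_lineDeriv_le (-(2 * (m + 1 : ℕ))) (-e) v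
  rw [norm_neg, hm] at h1
  rw [mul_assoc]
  exact (hC h hh _ g hv' fun x =>
    (hg x).trans (hF.kernelIntegral_kernelDeriv_right hh v e x)).trans
      (mul_le_mul_of_nonneg_left h1 hC0)

lemma HasOpBounds.exists_norm_le {l : ℝ} {F : E × E × ℝ → ℂ} (hF : IsProperKernel F)
    (hb : HasOpBounds l F) :
    ∃ C, ∀ h ∈ Set.Ioo (0 : ℝ) 1, ∀ x y, h ^ l * ‖F (x, y, h)‖ ≤ C := by
  obtain ⟨N, D, hD0, hD⟩ := exists_norm_le_bessel (E := E)
  obtain ⟨C, hC0, hC⟩ := hb N N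
  refine ⟨D * (D * C), fun h hh x y => ?_⟩
  have hl : 0 < h ^ l := Real.rpow_pos_of_pos hh.1 l
  have hφ : HasCompactSupport (bessel (2 * N) (hF.slice hh x)) :=
    hasCompactSupport_bessel_two_mul (hF.hasCompactSupport_slice hh x) N
  have hφn : ‖(bessel (2 * N) (hF.slice hh x)).toLp 2‖ ≤ D * C / h ^ l := by
    refine norm_toLp_le_of_norm_integral_mul_le hφ (by positivity) fun u hu => ?_
    obtain ⟨g, hg⟩ := hF.exists_schwartz (hasCompactSupport_bessel_two_mul hu N) hh
    have hgx : ∫ y, bessel (2 * N) (hF.slice hh x) y * u y = g x :=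
      (integral_mul_bessel N (hF.slice hh x) u).symm.trans (hg x).symm
    have h1 := hC h hh _ g (hasCompactSupport_bessel_two_mul hu N) hg
    rw [bessel_bessel, neg_add_cancel, bessel_zero] at h1
    have h2 := hD g x
    rw [hgx, div_mul_eq_mul_div, le_div_iff₀ hl]
    generalize ‖(bessel (2 * N) g).toLp 2‖ = a at h1 h2
    generalize ‖u.toLp 2‖ = b at h1 ⊢
    have h3 := mul_le_mul_of_nonneg_right h2 hl.le
    have h4 := mul_le_mul_of_nonneg_left h1 hD0
    linarith
  have h1 := hD (hF.slice hh x) y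
  rw [le_div_iff₀ hl] at hφn
  generalize ‖(bessel (2 * N) (hF.slice hh x)).toLp 2‖ = a at hφn h1
  have h2 := mul_le_mul_of_nonneg_left h1 hl.le
  have h3 := mul_le_mul_of_nonneg_left hφn hD0
  change h ^ l * ‖hF.slice hh x y‖ ≤ _
  linarith

lemma HasOpBounds.exists_norm_iteratedFDeriv_le {l : ℝ} {F : E × E × ℝ → ℂ}
    (hF : IsProperKernel F) (hb : HasOpBounds l F) (m : ℕ) :
    ∃ C, ∀ h ∈ Set.Ioo (0 : ℝ) 1, ∀ q : E × E,
      h ^ l * ‖iteratedFDeriv ℝ m (fun q : E × E => F (q.1, q.2, h)) q‖ ≤ C := by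
  have key := exists_norm_iteratedFDeriv_bound
    ((stdOrthonormalBasis ℝ E).toBasis.prod (stdOrthonormalBasis ℝ E).toBasis)
    (P := fun f : Set.Ioo (0 : ℝ) 1 → E × E → ℂ => ∃ G, IsProperKernel G ∧ HasOpBounds l G ∧
      f = fun (h : Set.Ioo (0 : ℝ) 1) (q : E × E) => G (q.1, q.2, (h : ℝ)))
    (ρ := fun h _ => (h : ℝ) ^ l) (fun h _ => Real.rpow_nonneg h.2.1.le l) ?_ ?_ ?_ m
    (fun h q => F (q.1, q.2, h)) ⟨F, hF, hb, rfl⟩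
  · obtain ⟨C, hC⟩ := key
    exact ⟨C, fun h hh q => hC ⟨h, hh⟩ q⟩
  · rintro _ ⟨G, hG, -, rfl⟩ h
    exact hG.contDiff_slice h.2
  · rintro _ ⟨G, hG, hGb, rfl⟩ (j | j)
    · refine ⟨_, hG.kernelDeriv _, hGb.kernelDeriv_left hG (stdOrthonormalBasis ℝ E j), ?_⟩
      ext h q
      simpa using hG.fderiv_slice h.2 q (stdOrthonormalBasis ℝ E j, 0)
    · refine ⟨_, hG.kernelDeriv _, hGb.kernelDeriv_right hG (stdOrthonormalBasis ℝ E j), ?_⟩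
      ext h q
      simpa using hG.fderiv_slice h.2 q (0, stdOrthonormalBasis ℝ E j)
  · rintro _ ⟨G, hG, hGb, rfl⟩
    obtain ⟨C, hC⟩ := hGb.exists_norm_le hG
    exact ⟨C, fun h q => hC h h.2 q.1 q.2⟩

end OperatorBounds

section Forward

variable {n}

lemma OpBounds.hasOpBounds {l : ℝ}
    {κ : EuclideanSpace ℝ (Fin n) → EuclideanSpace ℝ (Fin n) → ℝ → ℂ}
    (hκ : IsProperKernel (uncurryKernel κ)) (hb : OpBounds n l κ) (α : ℕ) :
    HasOpBounds l ((kernelDeriv (0, 0, 1))^[α] (uncurryKernel κ)) := by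
  intro N m
  obtain ⟨C, hC⟩ := hb α (2 * N) (2 * m)
  refine ⟨max C 0, le_max_right _ _, fun h hh v g hv hg => ?_⟩
  have hl : 0 ≤ h ^ l := Real.rpow_nonneg hh.1.le l
  have hv' : bessel (2 * m : ℕ) (bessel (-(2 * m)) v) = v := by
    rw [bessel_bessel, Nat.cast_mul, Nat.cast_ofNat, add_neg_cancel, bessel_zero]
  have h1 := hC (bessel (-(2 * m)) v) h hh.1 hh.2
  simp only [show (fun y => bessel (-(2 * m)) v y) = bessel (-(2 * m)) v from rfl,
    japaneseBracket_schwartz, hv', (isKernelClass_isProperKernel hv.isCompact).iterate_hDh_eq hκ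
      (subset_tsupport v) (2 * N) α hh hg] at h1
  have h2 : eLpNorm (fun x => (h ^ l : ℝ) • bessel (2 * N : ℕ) g x) 2 volume =
      ‖h ^ l‖ₑ * eLpNorm (bessel (2 * N : ℕ) g) 2 volume :=
    eLpNorm_const_smul (h ^ l) (bessel (2 * N : ℕ) g : EuclideanSpace ℝ (Fin n) → ℂ) 2 volume
  rw [h2] at h1
  have h3 := ENNReal.toReal_mono (ENNReal.mul_ne_top ENNReal.ofReal_ne_top
    (SchwartzMap.memLp _ _ _).eLpNorm_ne_top) h1
  rw [ENNReal.toReal_mul, ENNReal.toReal_mul, toReal_enorm, Real.norm_of_nonneg hl,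
    ENNReal.toReal_ofReal', ← SchwartzMap.norm_toLp, ← SchwartzMap.norm_toLp] at h3
  simpa using h3

lemma OpBounds.kerBounds {l : ℝ}
    {κ : EuclideanSpace ℝ (Fin n) → EuclideanSpace ℝ (Fin n) → ℝ → ℂ}
    (hκ : IsProperKernel (uncurryKernel κ)) (hb : OpBounds n l κ) : KerBounds n l κ := by
  intro α m
  obtain ⟨C, hC⟩ := (hb.hasOpBounds hκ α).exists_norm_iteratedFDeriv_le
    (hκ.iterate_kernelDeriv _ α) m
  refine ⟨C, fun h h0 h1 x y => ?_⟩
  simpa only [iterate_hDhK_eq hκ α ⟨h0, h1⟩] using hC h ⟨h0, h1⟩ (x, y)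

lemma KerBounds.hasKernelBounds {l : ℝ}
    {κ : EuclideanSpace ℝ (Fin n) → EuclideanSpace ℝ (Fin n) → ℝ → ℂ}
    (hκ : IsProperKernel (uncurryKernel κ)) (hb : KerBounds n l κ) :
    HasKernelBounds l (uncurryKernel κ) := by
  intro α m
  obtain ⟨C, hC⟩ := hb α m
  refine ⟨C, fun h hh q => ?_⟩
  simpa only [iterate_hDhK_eq hκ α hh] using hC h hh.1 hh.2 q.1 q.2

end Forward

end ResidualKernels

/-- Characterization of the residual calculus ℛ^l: for a smooth, properly supported
h-family of kernels κ, the uniform L² operator bounds for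
h^l (h∂_h)^α ⟨Δ⟩^β R ⟨Δ⟩^γ hold if and only if all kernel seminorms
sup |h^l (h∂_h)^α ∂_x^β ∂_y^γ κ| are finite. -/
theorem stmt_18 (l : ℝ)
    (κ : EuclideanSpace ℝ (Fin n) → EuclideanSpace ℝ (Fin n) → ℝ → ℂ)
    (hsm : ContDiffOn ℝ (⊤ : ℕ∞)
      (fun p : EuclideanSpace ℝ (Fin n) × EuclideanSpace ℝ (Fin n) × ℝ =>
        κ p.1 p.2.1 p.2.2)
      (Set.univ ×ˢ Set.univ ×ˢ Set.Ioo (0:ℝ) 1))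
    (hprop : ∃ M : ℝ, ∀ x y : EuclideanSpace ℝ (Fin n), ∀ h : ℝ,
      M < ‖x - y‖ → κ x y h = 0) :
    (OpBounds n l κ → KerBounds n l κ) ∧ (KerBounds n l κ → OpBounds n l κ) := by
  have hκ : IsProperKernel (uncurryKernel κ) :=
    ⟨hsm, hprop.imp fun M hM p hp => hM p.1 p.2.1 p.2.2 hp⟩
  exact ⟨fun h => h.kerBounds hκ, fun h => (h.hasKernelBounds hκ).opBounds hκ⟩

end
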